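/- arXiv:1910.13640 — 4 statements merged into one kernel-verified Lean document; each statement's English description precedes it below -/
import Mathlib

section
/- (Discrete parabolic Littlewood–Paley inequality.) In the setting of the discrete heat kernel G, for every p≥2 there is a constant N, depending only on p, d, d₁, δ₁*, δ₂*, the vectors l₁,…,l_{d₁} and ρ, such that for every finitely supported g : ℤ×ℤ^d→ℝ and every k∈{1,…,d}: Σ_{n∈ℤ} Σ_{x∈ℤ^d} ( Σ_{j=−∞}^{n−1} | (δ_{e_k}G(j,n,·)) ∗ g(j,·) (x) |² )^{p/2} ≤ N Σ_{(j,x)∈ℤ×ℤ^d}|g(j,x)|^p. -/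
open scoped ENNReal BigOperators

noncomputable section

/-- standard basis vector of `ℤ^d`. -/
def stdE (d : ℕ) (i : Fin d) : Fin d → ℤ := fun j => if j = i then 1 else 0

/-- forward difference quotient `δ_{ξ,h} f (x) = (f(x+hξ) - f(x))/h`, in lattice
representation (a function on `hℤ^d` is represented by its values on `ℤ^d`). -/
def fdiff {d : ℕ} (h : ℝ) (ξ : Fin d → ℤ) (f : (Fin d → ℤ) → ℝ) : (Fin d → ℤ) → ℝ :=
  fun x => (f (x + ξ) - f x) / h

/-- second difference quotient `Δ_{ξ,h} f (x) = (f(x+hξ) - 2f(x) + f(x-hξ))/h²`. -/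
def sdiff {d : ℕ} (h : ℝ) (ξ : Fin d → ℤ) (f : (Fin d → ℤ) → ℝ) : (Fin d → ℤ) → ℝ :=
  fun x => (f (x + ξ) - 2 * f x + f (x - ξ)) / h ^ 2

/-- mixed difference `δ^α_h = δ_{e_1,h}^{α_1} ⋯ δ_{e_d,h}^{α_d}`. -/
def mdiff {d : ℕ} (h : ℝ) (α : Fin d → ℕ) (f : (Fin d → ℤ) → ℝ) : (Fin d → ℤ) → ℝ :=
  (List.finRange d).foldr (fun i g => (fdiff h (stdE d i))^[α i] g) f

/-- discrete `l_p` norm `‖f‖_{p;h} = (h^d Σ_x |f(x)|^p)^{1/p}`. -/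
def lpN {d : ℕ} (p h : ℝ) (f : (Fin d → ℤ) → ℝ) : ℝ≥0∞ :=
  (ENNReal.ofReal h ^ d * ∑' x : Fin d → ℤ, ENNReal.ofReal (|f x| ^ p)) ^ (1 / p)

/-- discrete Sobolev seminorm `[f]_{s,p;h} = Σ_{|α|=s} ‖δ^α_h f‖_{p;h}`. -/
def semiN {d : ℕ} (p h : ℝ) (s : ℕ) (f : (Fin d → ℤ) → ℝ) : ℝ≥0∞ :=
  ∑ α ∈ Finset.univ.filter (fun α : Fin d → Fin (s + 1) => (∑ i, (α i : ℕ)) = s),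
    lpN p h (mdiff h (fun i => (α i : ℕ)) f)

/-- discrete Sobolev norm `‖f‖_{s,p;h} = Σ_{n=0}^s [f]_{n,p;h}`. -/
def sobN {d : ℕ} (p h : ℝ) (s : ℕ) (f : (Fin d → ℤ) → ℝ) : ℝ≥0∞ :=
  ∑ m ∈ Finset.range (s + 1), semiN p h m f

section DLPaux
open scoped NNReal
namespace DLP

/-- one-sided discrete maximal function -/
def mx (a : ℕ → ℝ≥0) (i : ℕ) : ℝ≥0 :=
  (Finset.range i).sup (fun s => (∑ t ∈ Finset.Ico s i, a t) / ((i - s : ℕ) : ℝ≥0))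

def qu (a : ℕ → ℝ) (lam : ℝ) : ℕ → ℝ
  | 0 => 0
  | (i+1) => max 0 (qu a lam i + a i - lam)

lemma qu_nonneg (a : ℕ → ℝ) (lam : ℝ) (i : ℕ) : 0 ≤ qu a lam i := by
  cases i <;> simp [qu]

lemma qu_ge (a : ℕ → ℝ) (lam : ℝ) (i s : ℕ) (h : s ≤ i) :
    ∑ t ∈ Finset.Ico s i, (a t - lam) ≤ qu a lam i := by
  induction i with
  | zero => simp [qu]
  | succ i ih =>
    rcases Nat.lt_or_ge i s with h1 | h1
    · have : s = i + 1 := by omega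
      subst this
      simpa using qu_nonneg a lam (i+1)
    · rw [Finset.sum_Ico_succ_top h1]
      have := ih h1
      simp only [qu]
      refine le_trans ?_ (le_max_right _ _)
      linarith

lemma qu_att (a : ℕ → ℝ) (lam : ℝ) (i : ℕ) (h : 0 < qu a lam i) :
    ∃ s < i, ∑ t ∈ Finset.Ico s i, (a t - lam) = qu a lam i := by
  induction i with
  | zero => simp [qu] at h
  | succ i ih =>
    have h2 : qu a lam (i+1) = qu a lam i + a i - lam := by
      simp only [qu] at h ⊢
      rcases lt_max_iff.1 h with h | h
      · exact absurd h (lt_irrefl _)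
      · exact max_eq_right h.le
    rcases (qu_nonneg a lam i).eq_or_lt with h3 | h3
    · exact ⟨i, by omega, by simp [h2, ← h3]⟩
    · obtain ⟨s, hs, e⟩ := ih h3
      exact ⟨s, by omega, by rw [Finset.sum_Ico_succ_top hs.le, e, h2]; ring⟩

lemma lt_mx (a : ℕ → ℝ≥0) (i : ℕ) (lam : ℝ) (hl : 0 ≤ lam) :
    lam < mx a i ↔ ∃ s < i, 0 < ∑ t ∈ Finset.Ico s i, ((a t : ℝ) - lam) := by
  lift lam to ℝ≥0 using hl
  rw [NNReal.coe_lt_coe, mx, Finset.lt_sup_iff]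
  simp only [Finset.mem_range]
  refine exists_congr fun s => and_congr_right fun hs => ?_
  have hp : (0:ℝ≥0) < ((i - s : ℕ) : ℝ≥0) := by
    have : 0 < i - s := by omega
    exact_mod_cast this
  rw [lt_div_iff₀ hp, ← NNReal.coe_lt_coe]
  simp only [Finset.sum_sub_distrib, Finset.sum_const, Nat.card_Ico, nsmul_eq_mul]
  rw [sub_pos, mul_comm]
  simp only [NNReal.coe_mul, NNReal.coe_natCast, NNReal.coe_sum]

lemma weak (a : ℕ → ℝ≥0) (lam : ℝ) (hl : 0 ≤ lam) (L : ℕ) :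
    0 ≤ ∑ i ∈ Finset.range L, if lam < mx a (i+1) then (a i : ℝ) - lam else 0 := by
  have : qu (fun i => (a i : ℝ)) lam L ≤
      ∑ i ∈ Finset.range L, if lam < mx a (i+1) then (a i : ℝ) - lam else 0 := by
    induction L with
    | zero => simp [qu]
    | succ i ih =>
      rw [Finset.sum_range_succ]
      split_ifs with h
      · obtain ⟨s, hs, h⟩ := (lt_mx a (i+1) lam hl).1 h
        have h1 := qu_ge (fun i => (a i : ℝ)) lam i s (by omega)
        rw [Finset.sum_Ico_succ_top (by omega)] at h
        simp only [qu]
        rw [max_eq_right (by linarith)]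
        linarith
      · rcases (qu_nonneg (fun i => (a i : ℝ)) lam (i+1)).eq_or_lt with h3 | h3
        · rw [← h3]
          have := qu_nonneg (fun i => (a i : ℝ)) lam i
          linarith
        · obtain ⟨s, hs, e⟩ := qu_att _ _ _ h3
          exact absurd ((lt_mx a (i+1) lam hl).2 ⟨s, hs, by rw [e]; exact h3⟩) h
  exact (qu_nonneg _ _ _).trans this

lemma integ (a m r B : ℝ) (hm : 0 ≤ m) (hB : m ≤ B) (hr : 1 < r) :
    IntervalIntegrable (fun x => (if x < m then a - x else 0) * x ^ (r-2)) MeasureTheory.volume 0 B ∧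
    ∫ x in (0:ℝ)..B, (if x < m then a - x else 0) * x ^ (r-2) =
      a * m ^ (r-1) / (r-1) - m ^ r / r := by
  have i0 : ∀ c d : ℝ, IntervalIntegrable (fun x : ℝ => a * x ^ (r-2) - x ^ (r-1)) MeasureTheory.volume c d := by
    intro c d
    exact ((intervalIntegral.intervalIntegrable_rpow' (by linarith)).const_mul a).sub
      (intervalIntegral.intervalIntegrable_rpow' (by linarith))
  have e1 : Set.EqOn (fun x : ℝ => a * x ^ (r-2) - x ^ (r-1))
      (fun x => (if x < m then a - x else 0) * x ^ (r-2)) (Set.Ioo 0 m) := by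
    intro x hx
    simp only [hx.2, if_true]
    have : x ^ (r-1) = x * x ^ (r-2) := by
      rw [show r - 1 = 1 + (r-2) by ring, Real.rpow_add hx.1, Real.rpow_one]
    rw [this]; ring
  have e2 : Set.EqOn (fun x : ℝ => (0:ℝ))
      (fun x => (if x < m then a - x else 0) * x ^ (r-2)) (Set.Ioo m B) := by
    intro x hx
    simp [not_lt.2 hx.1.le]
  have j1 : IntervalIntegrable (fun x => (if x < m then a - x else 0) * x ^ (r-2)) MeasureTheory.volume 0 m :=
    (i0 0 m).congr_uIoo (by rwa [Set.uIoo_of_le hm])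
  have j2 : IntervalIntegrable (fun x => (if x < m then a - x else 0) * x ^ (r-2)) MeasureTheory.volume m B :=
    (intervalIntegrable_const (c := (0:ℝ))).congr_uIoo (by rwa [Set.uIoo_of_le hB])
  refine ⟨j1.trans j2, ?_⟩
  rw [← intervalIntegral.integral_add_adjacent_intervals j1 j2]
  have k1 := intervalIntegral.integral_congr_uIoo (μ := MeasureTheory.volume) (show Set.EqOn _ _ (Set.uIoo 0 m) by rw [Set.uIoo_of_le hm]; exact e1)
  have k2 := intervalIntegral.integral_congr_uIoo (μ := MeasureTheory.volume) (show Set.EqOn _ _ (Set.uIoo m B) by rw [Set.uIoo_of_le hB]; exact e2)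
  rw [← k1, ← k2]
  rw [intervalIntegral.integral_sub, intervalIntegral.integral_const_mul, integral_rpow, integral_rpow]
  · rw [Real.zero_rpow (by linarith), Real.zero_rpow (by linarith)]
    simp
    rw [show r - 2 + 1 = r - 1 by ring]; ring
  · left; linarith
  · left; linarith
  · exact ((intervalIntegral.intervalIntegrable_rpow' (by linarith)).const_mul a)
  · exact (intervalIntegral.intervalIntegrable_rpow' (by linarith))

lemma strong1 (a : ℕ → ℝ≥0) (r : ℝ) (hr : 1 < r) (L : ℕ) :
    0 ≤ ∑ i ∈ Finset.range L,
      ((a i : ℝ) * (mx a (i+1) : ℝ) ^ (r-1) / (r-1) - (mx a (i+1) : ℝ) ^ r / r) := by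
  set B : ℝ≥0 := (Finset.range L).sup (fun i => mx a (i+1)) with hB
  have h1 : ∀ i ∈ Finset.range L, (mx a (i+1) : ℝ) ≤ B := fun i hi => by
    exact_mod_cast Finset.le_sup (f := fun i => mx a (i+1)) hi
  have h2 : ∑ i ∈ Finset.range L,
      ((a i : ℝ) * (mx a (i+1) : ℝ) ^ (r-1) / (r-1) - (mx a (i+1) : ℝ) ^ r / r)
      = ∑ i ∈ Finset.range L, ∫ x in (0:ℝ)..B, (if x < mx a (i+1) then (a i : ℝ) - x else 0) * x ^ (r-2) :=
    Finset.sum_congr rfl fun i hi => ((integ _ _ r B (NNReal.coe_nonneg _) (h1 i hi) hr).2).symm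
  rw [h2, ← intervalIntegral.integral_finsetSum
    (fun i hi => (integ _ _ r B (NNReal.coe_nonneg _) (h1 i hi) hr).1)]
  refine intervalIntegral.integral_nonneg (NNReal.coe_nonneg _) fun x hx => ?_
  rw [← Finset.sum_mul]
  exact mul_nonneg (weak a x hx.1 L) (Real.rpow_nonneg hx.1 _)

lemma young0 (q r K : ℝ) (ε : ℝ) (hr : 1 < r) (hq : q = r / (r-1)) (hK : 0 < K) (hε : 0 < ε)
    (a b : ℝ) (ha : 0 ≤ a) (hb : 0 ≤ b) :
    K * (a * b) ≤ ε * a ^ r + K * (K/ε)^(q-1) * b ^ q := by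
  have hq1 : q - 1 = 1/(r-1) := by rw [hq]; field_simp [show r - 1 ≠ 0 by linarith]; ring
  have hq0 : 0 < q - 1 := by rw [hq1]; have : 0 < r - 1 := by linarith
                             positivity
  have p1 : 0 ≤ a ^ r := Real.rpow_nonneg ha _
  have p2 : 0 ≤ K * (K/ε)^(q-1) * b ^ q := by positivity
  rcases le_or_gt (K * b) (ε * a ^ (r-1)) with h | h
  · have : a ^ r = a * a ^ (r-1) := by
      rcases ha.eq_or_lt with h0 | h0
      · rw [← h0, Real.zero_rpow (by linarith)]; simp
      · conv_lhs => rw [show r = 1 + (r-1) by ring, Real.rpow_add h0, Real.rpow_one]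
    rw [this]
    nlinarith [mul_le_mul_of_nonneg_left h ha]
  · have h3 : a ^ (r-1) ≤ (K/ε) * b := by
      rw [div_mul_eq_mul_div, le_div_iff₀ hε]; linarith
    have h4 : a ≤ ((K/ε) * b) ^ (q-1) := by
      have := Real.rpow_le_rpow (Real.rpow_nonneg ha _) h3 hq0.le
      rwa [← Real.rpow_mul ha, hq1, mul_one_div_cancel (by linarith), Real.rpow_one, ← hq1] at this
    rw [Real.mul_rpow (by positivity) hb] at h4
    have : b ^ q = b * b ^ (q-1) := by
      rcases hb.eq_or_lt with h0 | h0
      · rw [← h0, Real.zero_rpow (by linarith)]; simp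
      · conv_lhs => rw [show q = 1 + (q-1) by ring, Real.rpow_add h0, Real.rpow_one]
    rw [this]
    have h5 := mul_le_mul_of_nonneg_left h4 (mul_nonneg hK.le hb)
    have h6 : 0 ≤ ε * a ^ r := by positivity
    nlinarith

lemma strong (r : ℝ) (hr : 1 < r) : ∃ C : ℝ≥0, 0 < C ∧ ∀ (a : ℕ → ℝ≥0) (L : ℕ),
    ∑ i ∈ Finset.range (L+1), (mx a i) ^ r ≤ C * ∑ i ∈ Finset.range L, (a i) ^ r := by
  have hr0 : 0 < r - 1 := by linarith
  set q := r / (r-1) with hq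
  have hq1 : q - 1 = 1/(r-1) := by rw [hq]; field_simp [show r - 1 ≠ 0 by linarith]; ring
  have hrq : r = q / (q-1) := by rw [hq1, hq]; field_simp
  have hq2 : 1 < q := by
    have : 0 < q - 1 := by rw [hq1]; positivity
    linarith
  set D : ℝ := (1/(r-1)) * ((1/(r-1))/(1/(2*r)))^(r-1) with hD
  have hDp : 0 < D := by positivity
  refine ⟨Real.toNNReal (2*r*D), by rw [Real.toNNReal_pos]; positivity, fun a L => ?_⟩
  rw [Finset.sum_range_succ']
  have z : (mx a 0) ^ r = 0 := by simp [mx, show r ≠ 0 by linarith]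
  rw [z, add_zero, ← NNReal.coe_le_coe]
  push_cast
  rw [Real.coe_toNNReal _ (by positivity)]
  have h := strong1 a r hr L
  have h2 : ∀ i ∈ Finset.range L, ((a i : ℝ) * (mx a (i+1) : ℝ) ^ (r-1) / (r-1) - (mx a (i+1) : ℝ) ^ r / r)
      ≤ D * (a i : ℝ) ^ r - (1/(2*r)) * (mx a (i+1) : ℝ) ^ r := by
    intro i hi
    have := young0 r q (1/(r-1)) (1/(2*r)) hq2 hrq (by positivity) (by positivity)
      ((mx a (i+1) : ℝ) ^ (r-1)) (a i) (by positivity) (by positivity)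
    rw [← Real.rpow_mul (NNReal.coe_nonneg _), show (r-1)*q = r by rw [hq]; field_simp, ← hD] at this
    have e : (mx a (i+1) : ℝ) ^ r / r = 2 * ((1/(2*r)) * (mx a (i+1) : ℝ) ^ r) := by field_simp
    rw [e]
    have e2 : (a i : ℝ) * (mx a (i+1) : ℝ) ^ (r-1) / (r-1) = 1/(r-1) * ((mx a (i+1) : ℝ) ^ (r-1) * a i) := by ring
    rw [e2]; linarith
  have h3 := h.trans (Finset.sum_le_sum h2)
  rw [Finset.sum_sub_distrib, ← Finset.mul_sum, ← Finset.mul_sum, sub_nonneg] at h3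
  have h4 := mul_le_mul_of_nonneg_left h3 (show 0 ≤ 2*r by linarith)
  rw [← mul_assoc, ← mul_assoc, mul_one_div_cancel (by positivity), one_mul] at h4
  exact h4
section path
variable {X Ξ : Type} [AddCommGroup X] [Fintype Ξ]

/-- path expectation started from counting measure -/
def Ex (w : ℕ → Ξ → ℝ) (s : Ξ → X) : ℕ → ((ℕ → X) → ℝ≥0∞) → ℝ≥0∞
  | 0, F => ∑' x, F (fun _ => x)
  | (t+1), F => Ex w s t (fun ω => ∑ ξ, ENNReal.ofReal (w t ξ) * F (Function.update ω (t+1) (ω t + s ξ)))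

/-- one step operator -/
def Pt (w : ℕ → Ξ → ℝ) (s : Ξ → X) (t : ℕ) (f : X → ℝ≥0∞) (x : X) : ℝ≥0∞ :=
  ∑ ξ, ENNReal.ofReal (w t ξ) * f (x + s ξ)

/-- depends only on coordinates up to t -/
def Dep (t : ℕ) {β : Type} (F : (ℕ → X) → β) : Prop :=
  ∀ ω ω' : ℕ → X, (∀ r ≤ t, ω r = ω' r) → F ω = F ω'

variable (w : ℕ → Ξ → ℝ) (s : Ξ → X)

lemma Ex_mono (t : ℕ) {F H : (ℕ → X) → ℝ≥0∞} (h : ∀ ω, F ω ≤ H ω) : Ex w s t F ≤ Ex w s t H := by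
  induction t generalizing F H with
  | zero => exact ENNReal.tsum_le_tsum fun x => h _
  | succ t ih => exact ih fun ω => Finset.sum_le_sum fun ξ _ => by gcongr; exact h _

lemma Ex_zero (t : ℕ) : Ex w s t (fun _ => 0) = 0 := by
  induction t with
  | zero => simp [Ex]
  | succ t ih => simpa [Ex] using ih

lemma Ex_add (t : ℕ) (F H : (ℕ → X) → ℝ≥0∞) :
    Ex w s t (fun ω => F ω + H ω) = Ex w s t F + Ex w s t H := by
  induction t generalizing F H with
  | zero => exact ENNReal.tsum_add
  | succ t ih => simp only [Ex, ← ih, mul_add, Finset.sum_add_distrib]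

lemma Ex_mul (t : ℕ) (c : ℝ≥0∞) (F : (ℕ → X) → ℝ≥0∞) :
    Ex w s t (fun ω => c * F ω) = c * Ex w s t F := by
  induction t generalizing F with
  | zero => exact ENNReal.tsum_mul_left
  | succ t ih => simp only [Ex, ← ih, Finset.mul_sum, mul_left_comm]

lemma Ex_sum (t : ℕ) {ι : Type} (S : Finset ι) (F : ι → (ℕ → X) → ℝ≥0∞) :
    Ex w s t (fun ω => ∑ i ∈ S, F i ω) = ∑ i ∈ S, Ex w s t (F i) := by
  classical
  induction S using Finset.induction_on with
  | empty => simp [Ex_zero]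
  | insert a S ha ih => simp only [Finset.sum_insert ha, Ex_add, ih]

lemma Ex_step (t : ℕ) (H : (ℕ → X) → ℝ≥0∞) (hH : Dep t H) (f : X → ℝ≥0∞) :
    Ex w s (t+1) (fun ω => H ω * f (ω (t+1))) = Ex w s t (fun ω => H ω * Pt w s t f (ω t)) := by
  simp only [Ex]
  congr 1
  funext ω
  simp only [Pt, Finset.mul_sum, Function.update_self]
  refine Finset.sum_congr rfl fun ξ _ => ?_
  rw [hH (Function.update ω (t+1) (ω t + s ξ)) ω
    (fun r hr => Function.update_of_ne (by omega) _ _)]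
  ring

lemma wsum (hw : ∀ t ξ, 0 ≤ w t ξ) (hw1 : ∀ t, ∑ ξ, w t ξ = 1) (t : ℕ) : ∑ ξ, ENNReal.ofReal (w t ξ) = 1 := by
  rw [← ENNReal.ofReal_sum_of_nonneg (fun ξ _ => hw t ξ), hw1]; simp

lemma Ex_dep (hw : ∀ t ξ, 0 ≤ w t ξ) (hw1 : ∀ t, ∑ ξ, w t ξ = 1) (t u : ℕ) (h : t ≤ u) (H : (ℕ → X) → ℝ≥0∞) (hH : Dep t H) :
    Ex w s u H = Ex w s t H := by
  induction u, h using Nat.le_induction with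
  | base => rfl
  | succ u hu ih =>
    have := Ex_step w s u H (fun ω ω' h => hH ω ω' fun r hr => h r (hr.trans hu)) (fun _ => 1)
    simp only [Pt, mul_one, wsum w hw hw1] at this
    rw [this, ih]

lemma Ex_marg_step (t : ℕ) (f : X → ℝ≥0∞) :
    ∑' x, Pt w s t f x = (∑ ξ, ENNReal.ofReal (w t ξ)) * ∑' x, f x := by
  simp only [Pt]
  rw [Summable.tsum_finsetSum (fun _ _ => ENNReal.summable), Finset.sum_mul]
  refine Finset.sum_congr rfl fun ξ _ => ?_
  rw [ENNReal.tsum_mul_left, (Equiv.addRight (s ξ)).tsum_eq f |>.symm]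
  rfl

lemma Ex_marg (hw : ∀ t ξ, 0 ≤ w t ξ) (hw1 : ∀ t, ∑ ξ, w t ξ = 1) (t : ℕ) (f : X → ℝ≥0∞) : Ex w s t (fun ω => f (ω t)) = ∑' x, f x := by
  induction t generalizing f with
  | zero => rfl
  | succ t ih =>
    have := Ex_step w s t (fun _ => 1) (fun _ _ _ => rfl) f
    simp only [one_mul] at this
    rw [this, ih, Ex_marg_step, wsum w hw hw1, one_mul]

lemma Ex_trans (t : ℕ) (e : X) (F : (ℕ → X) → ℝ≥0∞) :
    Ex w s t (fun ω => F (fun r => ω r + e)) = Ex w s t F := by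
  induction t generalizing F with
  | zero => exact (Equiv.addRight e).tsum_eq (fun x => F (fun _ => x))
  | succ t ih =>
    simp only [Ex]
    refine Eq.trans ?_ (ih _)
    congr 1
    funext ω
    refine Finset.sum_congr rfl fun ξ _ => ?_
    congr 2
    funext r
    by_cases h : r = t+1
    · subst h; simp; abel
    · simp [Function.update_of_ne h]


/-- square in ENNReal -/
def sq (a : ℝ) : ℝ≥0∞ := ENNReal.ofReal (a ^ 2)

def Va (u : ℕ → X → ℝ) (t : ℕ) (x : X) : ℝ≥0∞ :=
  ∑ ξ, ENNReal.ofReal (w t ξ) * sq (u (t+1) (x + s ξ) - u t x)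

def Df (e : X) (u : ℕ → X → ℝ) (t : ℕ) (x : X) : ℝ≥0∞ := sq (u t (x + e) - u t x)

lemma wsq (hw : ∀ t ξ, 0 ≤ w t ξ) (t : ℕ) (f : Ξ → ℝ) :
    ∑ ξ, ENNReal.ofReal (w t ξ) * sq (f ξ) = ENNReal.ofReal (∑ ξ, w t ξ * f ξ ^ 2) := by
  rw [ENNReal.ofReal_sum_of_nonneg (fun ξ _ => mul_nonneg (hw t ξ) (sq_nonneg _))]
  exact Finset.sum_congr rfl fun ξ _ => (ENNReal.ofReal_mul (hw t ξ)).symm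

lemma var_real (hw1 : ∀ t, ∑ ξ, w t ξ = 1) (t : ℕ) (f : Ξ → ℝ) (m : ℝ) (hm : m = ∑ ξ, w t ξ * f ξ) :
    ∑ ξ, w t ξ * f ξ ^ 2 = m ^ 2 + ∑ ξ, w t ξ * (f ξ - m) ^ 2 := by
  have h : ∀ ξ, w t ξ * (f ξ - m) ^ 2 = w t ξ * f ξ ^ 2 - 2 * m * (w t ξ * f ξ) + m ^ 2 * w t ξ := by
    intro ξ; ring
  simp only [h, Finset.sum_add_distrib, Finset.sum_sub_distrib, ← Finset.mul_sum, hw1, ← hm]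
  ring

lemma var (hw : ∀ t ξ, 0 ≤ w t ξ) (hw1 : ∀ t, ∑ ξ, w t ξ = 1) (u : ℕ → X → ℝ) (t : ℕ)
    (hu : ∀ x, u t x = ∑ ξ, w t ξ * u (t+1) (x + s ξ)) (x : X) :
    Pt w s t (fun y => sq (u (t+1) y)) x = sq (u t x) + Va w s u t x := by
  simp only [Pt, Va]
  rw [wsq w hw, wsq w hw, sq, var_real w hw1 t _ _ (hu x), ENNReal.ofReal_add (sq_nonneg _)]
  exact Finset.sum_nonneg fun ξ _ => mul_nonneg (hw t ξ) (sq_nonneg _)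

lemma jens (hw : ∀ t ξ, 0 ≤ w t ξ) (hw1 : ∀ t, ∑ ξ, w t ξ = 1) (e : X) (u : ℕ → X → ℝ) (t : ℕ)
    (hu : ∀ x, u t x = ∑ ξ, w t ξ * u (t+1) (x + s ξ)) (x : X) :
    Df e u t x ≤ Pt w s t (Df e u (t+1)) x := by
  simp only [Pt, Df]
  rw [wsq w hw, sq]
  apply ENNReal.ofReal_le_ofReal
  rw [var_real w hw1 t _ (u t (x+e) - u t x)]
  · have := Finset.sum_nonneg (s := Finset.univ) fun ξ _ => mul_nonneg (hw t ξ)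
      (sq_nonneg (u (t+1) (x + s ξ + e) - u (t+1) (x + s ξ) - (u t (x+e) - u t x)))
    linarith
  · rw [hu, hu x, ← Finset.sum_sub_distrib]
    refine Finset.sum_congr rfl fun ξ _ => ?_
    rw [show x + e + s ξ = x + s ξ + e by abel]; ring

lemma comp (hw : ∀ t ξ, 0 ≤ w t ξ) (c : ℝ) (hc : 0 < c)
    (o k : Ξ) (ho : s o = 0) (hco : ∀ t, c ≤ w t o) (hck : ∀ t, c ≤ w t k)
    (u : ℕ → X → ℝ) (t : ℕ) (x : X) :
    Df (s k) u t x ≤ ENNReal.ofReal (2/c) * (Va w s u t x + Va w s u t (x + s k)) := by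
  simp only [Va, Df]
  rw [wsq w hw, wsq w hw, sq]
  have p : ∀ x, 0 ≤ ∑ ξ, w t ξ * (u (t+1) (x + s ξ) - u t x) ^ 2 := fun x =>
    Finset.sum_nonneg fun ξ _ => mul_nonneg (hw t ξ) (sq_nonneg _)
  rw [← ENNReal.ofReal_add (p _) (p _), ← ENNReal.ofReal_mul (by positivity)]
  apply ENNReal.ofReal_le_ofReal
  have h : ∀ x η, c ≤ w t η → c * (u (t+1) (x + s η) - u t x) ^ 2 ≤
      ∑ ξ, w t ξ * (u (t+1) (x + s ξ) - u t x) ^ 2 := fun x η hη => by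
    refine le_trans (mul_le_mul_of_nonneg_right hη (sq_nonneg _)) ?_
    exact Finset.single_le_sum (f := fun ξ => w t ξ * (u (t+1) (x + s ξ) - u t x) ^ 2)
      (fun ξ _ => mul_nonneg (hw t ξ) (sq_nonneg _)) (Finset.mem_univ η)
  have h1 := h x k (hck t)
  have h2 := h (x + s k) o (hco t)
  rw [ho, add_zero] at h2
  rw [div_mul_eq_mul_div, le_div_iff₀ hc]
  set A := u (t+1) (x + s k)
  have : (u t (x + s k) - u t x)^2 ≤ 2 * (A - u t x)^2 + 2 * (A - u t (x + s k))^2 := by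
    nlinarith [sq_nonneg ((A - u t x) + (A - u t (x + s k)))]
  nlinarith

lemma chain (hw : ∀ t ξ, 0 ≤ w t ξ) (hw1 : ∀ t, ∑ ξ, w t ξ = 1) (e : X) (u : ℕ → X → ℝ) (i : ℕ)
    (hu : ∀ t < i, ∀ x, u t x = ∑ ξ, w t ξ * u (t+1) (x + s ξ)) (t r : ℕ) (h : t ≤ r) (hr : r ≤ i)
    (H : (ℕ → X) → ℝ≥0∞) (hH : Dep t H) :
    Ex w s t (fun ω => H ω * Df e u t (ω t)) ≤ Ex w s r (fun ω => H ω * Df e u r (ω r)) := by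
  induction r, h using Nat.le_induction with
  | base => rfl
  | succ r h ih =>
    refine (ih (by omega)).trans ?_
    rw [Ex_step w s r H (fun ω ω' h' => hH ω ω' fun r' hr' => h' r' (hr'.trans h))]
    exact Ex_mono w s r fun ω => by
      gcongr
      exact jens w s hw hw1 e u r (hu r (by omega)) _

lemma key1 (hw : ∀ t ξ, 0 ≤ w t ξ) (hw1 : ∀ t, ∑ ξ, w t ξ = 1) (c : ℝ) (hc : 0 < c)
    (o k : Ξ) (ho : s o = 0) (hco : ∀ t, c ≤ w t o) (hck : ∀ t, c ≤ w t k)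
    (u : ℕ → X → ℝ) (i : ℕ)
    (hu : ∀ t < i, ∀ x, u t x = ∑ ξ, w t ξ * u (t+1) (x + s ξ)) (t r : ℕ) (h : t ≤ r) (hr : r < i)
    (φ : X → ℝ≥0) :
    ∑' x, (φ x : ℝ≥0∞) * Df (s k) u t x ≤ ENNReal.ofReal (2/c) *
      Ex w s r (fun ω => ((φ (ω t) + φ (ω t - s k) : ℝ≥0) : ℝ≥0∞) * Va w s u r (ω r)) := by
  rw [← Ex_marg w s hw hw1 t]
  refine (chain w s hw hw1 (s k) u i hu t r h hr.le (fun ω => (φ (ω t) : ℝ≥0∞))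
    (fun ω ω' h' => by simp only [h' t le_rfl])).trans ?_
  have e1 : Ex w s r (fun ω => ((φ (ω t) + φ (ω t - s k) : ℝ≥0) : ℝ≥0∞) * Va w s u r (ω r))
      = Ex w s r (fun ω => (φ (ω t) : ℝ≥0∞) * (Va w s u r (ω r) + Va w s u r (ω r + s k))) := by
    simp only [ENNReal.coe_add, add_mul, mul_add]
    rw [Ex_add, Ex_add]
    congr 1
    rw [← Ex_trans w s r (s k)]
    simp only [add_sub_cancel_right]
  rw [e1, ← Ex_mul]
  refine Ex_mono w s r fun ω => ?_
  rw [mul_left_comm]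
  gcongr
  exact comp w s hw c hc o k ho hco hck u r _

lemma tele (hw : ∀ t ξ, 0 ≤ w t ξ) (hw1 : ∀ t, ∑ ξ, w t ξ = 1) (u : ℕ → X → ℝ) (i : ℕ)
    (hu : ∀ t < i, ∀ x, u t x = ∑ ξ, w t ξ * u (t+1) (x + s ξ))
    (W : ℕ → (ℕ → X) → ℝ≥0∞) (hW : ∀ r, Dep r (W r)) (n : ℕ) (hn : n ≤ i) :
    ∑ r ∈ Finset.range n, Ex w s r (fun ω => W r ω * Va w s u r (ω r)) ≤
      Ex w s n (fun ω => (Finset.range n).sup (fun r => W r ω) * sq (u n (ω n))) := by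
  induction n with
  | zero => simp
  | succ n ih =>
    rw [Finset.sum_range_succ]
    have hd : Dep n (fun ω => (Finset.range (n+1)).sup (fun r => W r ω)) := by
      intro ω ω' h
      refine Finset.sup_congr rfl fun r hr => hW r _ _ fun r' hr' => h r' ?_
      have := Finset.mem_range.1 hr
      omega
    rw [Ex_step w s n _ hd (fun y => sq (u (n+1) y))]
    refine (add_le_add_left (ih (by omega)) _).trans ?_
    rw [← Ex_add]
    refine Ex_mono w s n fun ω => ?_
    rw [var w s hw hw1 u n (hu n (by omega)), mul_add]
    gcongr
    · simp
    · exact Finset.le_sup (f := fun r => W r ω) (by simp)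

lemma W_le (a : ℕ → ℝ≥0) (i r : ℕ) (hr : r < i) :
    ∑ t ∈ (Finset.range (r+1)).filter (fun t => r < t + (i-t+1)/2), a t * (((i-t+1)/2 : ℕ) : ℝ≥0)⁻¹
      ≤ 4 * mx a i := by
  have he : 0 < ((i - r : ℕ) : ℝ≥0) := by
    have : 0 < i - r := by omega
    exact_mod_cast this
  have h1 : ∑ t ∈ (Finset.range (r+1)).filter (fun t => r < t + (i-t+1)/2),
      a t * (((i-t+1)/2 : ℕ) : ℝ≥0)⁻¹ ≤ ∑ t ∈ Finset.Ico (2*r+1-i) i, a t * (2 / ((i - r : ℕ) : ℝ≥0)) := by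
    refine (Finset.sum_le_sum fun t ht => ?_).trans
      (Finset.sum_le_sum_of_subset (f := fun t => a t * (2 / ((i - r : ℕ) : ℝ≥0))) ?_)
    · simp only [Finset.mem_filter, Finset.mem_range] at ht
      gcongr
      rw [inv_le_comm₀ _ (by positivity), inv_div, div_le_iff₀ (by norm_num)]
      · have : i - r ≤ (i-t+1)/2 * 2 := by omega
        exact_mod_cast this
      · have : 0 < (i-t+1)/2 := by omega
        exact_mod_cast this
    · intro t ht
      simp only [Finset.mem_filter, Finset.mem_range, Finset.mem_Ico] at ht ⊢
      omega
  refine h1.trans ?_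
  rw [← Finset.sum_mul]
  have h2 : (∑ t ∈ Finset.Ico (2*r+1-i) i, a t) / ((i - (2*r+1-i) : ℕ) : ℝ≥0) ≤ mx a i :=
    Finset.le_sup (f := fun s => (∑ t ∈ Finset.Ico s i, a t) / ((i - s : ℕ) : ℝ≥0))
      (by simp; omega)
  rw [div_le_iff₀ (by have : 0 < i - (2*r+1-i) := by omega
                      exact_mod_cast this)] at h2
  have h3 : ((i - (2*r+1-i) : ℕ) : ℝ≥0) ≤ 2 * ((i - r : ℕ) : ℝ≥0) := by
    have : i - (2*r+1-i) ≤ 2 * (i-r) := by omega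
    exact_mod_cast this
  calc _ ≤ (mx a i * (2 * ((i - r : ℕ) : ℝ≥0))) * (2 / ((i - r : ℕ) : ℝ≥0)) := by
        gcongr; exact h2.trans (by gcongr)
    _ = _ := by field_simp; norm_num

lemma key2 (hw : ∀ t ξ, 0 ≤ w t ξ) (hw1 : ∀ t, ∑ ξ, w t ξ = 1) (c : ℝ) (hc : 0 < c)
    (o k : Ξ) (ho : s o = 0) (hco : ∀ t, c ≤ w t o) (hck : ∀ t, c ≤ w t k)
    (u : ℕ → X → ℝ) (i : ℕ)
    (hu : ∀ t < i, ∀ x, u t x = ∑ ξ, w t ξ * u (t+1) (x + s ξ))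
    (φ : ℕ → X → ℝ≥0) :
    ∑ t ∈ Finset.range i, ∑' x, (φ t x : ℝ≥0∞) * Df (s k) u t x ≤ ENNReal.ofReal (8/c) *
      Ex w s i (fun ω => (mx (fun t => φ t (ω t) + φ t (ω t - s k)) i : ℝ≥0∞) * sq (u i (ω i))) := by
  set W : ℕ → (ℕ → X) → ℝ≥0∞ := fun r ω =>
    ((∑ t ∈ (Finset.range (r+1)).filter (fun t => r < t + (i-t+1)/2),
      (φ t (ω t) + φ t (ω t - s k)) * (((i-t+1)/2 : ℕ) : ℝ≥0)⁻¹ : ℝ≥0) : ℝ≥0∞) with hWd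
  have hW : ∀ r, Dep r (W r) := by
    intro r ω ω' h
    simp only [hWd]
    congr 1
    refine Finset.sum_congr rfl fun t ht => ?_
    simp only [Finset.mem_filter, Finset.mem_range] at ht
    rw [h t (by omega)]
  have h1 : ∀ t ∈ Finset.range i, ∑' x, (φ t x : ℝ≥0∞) * Df (s k) u t x ≤
      ∑ r ∈ Finset.Ico t (t + (i-t+1)/2), ENNReal.ofReal (2/c) * Ex w s r (fun ω =>
        (((φ t (ω t) + φ t (ω t - s k)) * (((i-t+1)/2 : ℕ) : ℝ≥0)⁻¹ : ℝ≥0) : ℝ≥0∞) * Va w s u r (ω r)) := by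
    intro t ht
    have ht := Finset.mem_range.1 ht
    have hn : (((i-t+1)/2 : ℕ) : ℝ≥0) ≠ 0 := by
      have : (i-t+1)/2 ≠ 0 := by omega
      exact_mod_cast this
    set Z := ∑' x, (φ t x : ℝ≥0∞) * Df (s k) u t x
    have : Z = ∑ r ∈ Finset.Ico t (t + (i-t+1)/2), (((((i-t+1)/2 : ℕ) : ℝ≥0)⁻¹ : ℝ≥0) : ℝ≥0∞) * Z := by
      rw [Finset.sum_const, Nat.card_Ico, Nat.add_sub_cancel_left, nsmul_eq_mul, ← mul_assoc,
        ← ENNReal.coe_natCast, ← ENNReal.coe_mul, mul_inv_cancel₀ hn]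
      simp
    rw [this]
    refine Finset.sum_le_sum fun r hr => ?_
    simp only [Finset.mem_Ico] at hr
    have := key1 w s hw hw1 c hc o k ho hco hck u i hu t r hr.1 (by omega) (φ t)
    refine (mul_le_mul_right this _).trans (le_of_eq ?_)
    rw [mul_left_comm, ← Ex_mul]
    congr 2
    funext ω
    rw [ENNReal.coe_mul, ← mul_assoc]
    congr 1
    rw [mul_comm]
  refine (Finset.sum_le_sum h1).trans ?_
  rw [Finset.sum_comm' (t' := Finset.range i)
    (s' := fun r => (Finset.range (r+1)).filter (fun t => r < t + (i-t+1)/2))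
    (fun t r => by simp only [Finset.mem_filter, Finset.mem_range, Finset.mem_Ico]; omega)]
  have h2 : ∀ r, ∑ t ∈ (Finset.range (r+1)).filter (fun t => r < t + (i-t+1)/2),
      ENNReal.ofReal (2/c) * Ex w s r (fun ω =>
        (((φ t (ω t) + φ t (ω t - s k)) * (((i-t+1)/2 : ℕ) : ℝ≥0)⁻¹ : ℝ≥0) : ℝ≥0∞) * Va w s u r (ω r))
      = ENNReal.ofReal (2/c) * Ex w s r (fun ω => W r ω * Va w s u r (ω r)) := by
    intro r
    rw [← Finset.mul_sum, ← Ex_sum]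
    congr 2
    funext ω
    simp only [hWd]
    rw [ENNReal.ofNNReal_finsetSum, Finset.sum_mul]
  simp only [h2]
  rw [← Finset.mul_sum]
  refine (mul_le_mul_right (tele w s hw hw1 u i hu W hW i le_rfl) _).trans ?_
  rw [show 8/c = (2/c)*4 by ring, ENNReal.ofReal_mul (by positivity), mul_assoc]
  gcongr
  rw [← Ex_mul]
  refine Ex_mono w s i fun ω => ?_
  rw [← mul_assoc]
  gcongr
  refine Finset.sup_le fun r hr => ?_
  have := W_le (fun t => φ t (ω t) + φ t (ω t - s k)) i r (Finset.mem_range.1 hr)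
  simp only [hWd]
  refine (ENNReal.coe_le_coe.2 this).trans ?_
  simp


def Ss (e : X) (u : ℕ → ℕ → X → ℝ) (L : ℕ) (z : ℕ × X) : ℝ≥0∞ :=
  ∑ i ∈ Finset.range (L+1), if z.1 < i then Df e (u i) z.1 z.2 else 0

lemma key3 (hw : ∀ t ξ, 0 ≤ w t ξ) (hw1 : ∀ t, ∑ ξ, w t ξ = 1) (c : ℝ) (hc : 0 < c)
    (o k : Ξ) (ho : s o = 0) (hco : ∀ t, c ≤ w t o) (hck : ∀ t, c ≤ w t k)
    (u : ℕ → ℕ → X → ℝ) (L : ℕ)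
    (hu : ∀ i, ∀ t < i, ∀ x, u i t x = ∑ ξ, w t ξ * u i (t+1) (x + s ξ))
    (φ : ℕ → X → ℝ≥0) :
    ∑' z : ℕ × X, (φ z.1 z.2 : ℝ≥0∞) * Ss (s k) u L z ≤ ENNReal.ofReal (8/c) *
      ∑ i ∈ Finset.range (L+1), Ex w s i (fun ω =>
        (mx (fun t => φ t (ω t) + φ t (ω t - s k)) i : ℝ≥0∞) * sq (u i i (ω i))) := by
  simp only [Ss, Finset.mul_sum]
  rw [Summable.tsum_finsetSum (fun _ _ => ENNReal.summable)]
  refine Finset.sum_le_sum fun i _ => ?_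
  refine le_trans (le_of_eq ?_) (key2 w s hw hw1 c hc o k ho hco hck (u i) i (hu i) φ)
  rw [ENNReal.tsum_prod', tsum_eq_sum (s := Finset.range i)]
  · refine Finset.sum_congr rfl fun t ht => ?_
    simp [Finset.mem_range.1 ht]
  · intro t ht
    simp only [Finset.mem_range] at ht
    simp [ht]

lemma mx_dep (e : X) (φ : ℕ → X → ℝ≥0) (i : ℕ) :
    Dep i (fun ω : ℕ → X => mx (fun t => φ t (ω t) + φ t (ω t - e)) i) := by
  intro ω ω' h
  refine Finset.sup_congr rfl fun r hr => ?_
  congr 1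
  refine Finset.sum_congr rfl fun t ht => ?_
  simp only [h t (Finset.mem_Ico.1 ht).2.le]

lemma mxb (hw : ∀ t ξ, 0 ≤ w t ξ) (hw1 : ∀ t, ∑ ξ, w t ξ = 1) (e : X) (r : ℝ) (hr : 1 < r)
    (C : ℝ≥0) (hC : ∀ (a : ℕ → ℝ≥0) (L : ℕ),
      ∑ i ∈ Finset.range (L+1), (mx a i) ^ r ≤ C * ∑ i ∈ Finset.range L, (a i) ^ r)
    (φ : ℕ → X → ℝ≥0) (L : ℕ) :
    ∑ i ∈ Finset.range (L+1), Ex w s i (fun ω =>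
        ((mx (fun t => φ t (ω t) + φ t (ω t - e)) i ^ r : ℝ≥0) : ℝ≥0∞)) ≤
      ((C * 2 ^ r : ℝ≥0) : ℝ≥0∞) * ∑' z : ℕ × X, ((φ z.1 z.2 ^ r : ℝ≥0) : ℝ≥0∞) := by
  have h1 : ∑ i ∈ Finset.range (L+1), Ex w s i (fun ω =>
        ((mx (fun t => φ t (ω t) + φ t (ω t - e)) i ^ r : ℝ≥0) : ℝ≥0∞))
      = Ex w s L (fun ω => ∑ i ∈ Finset.range (L+1),
        ((mx (fun t => φ t (ω t) + φ t (ω t - e)) i ^ r : ℝ≥0) : ℝ≥0∞)) := by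
    rw [Ex_sum]
    refine Finset.sum_congr rfl fun i hi => ?_
    have := Finset.mem_range.1 hi
    exact (Ex_dep w s hw hw1 i L (by omega) _ fun ω ω' h => by
      have := mx_dep e φ i ω ω' h
      simp only at this
      rw [this]).symm
  rw [h1]
  have h2 : ∀ ω : ℕ → X, ∑ i ∈ Finset.range (L+1),
        ((mx (fun t => φ t (ω t) + φ t (ω t - e)) i ^ r : ℝ≥0) : ℝ≥0∞) ≤
      ((C * 2 ^ (r-1) : ℝ≥0) : ℝ≥0∞) * ∑ t ∈ Finset.range L,
        (((φ t (ω t) ^ r : ℝ≥0) : ℝ≥0∞) + ((φ t (ω t - e) ^ r : ℝ≥0) : ℝ≥0∞)) := by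
    intro ω
    have a1 := hC (fun t => φ t (ω t) + φ t (ω t - e)) L
    have a2 : ∑ t ∈ Finset.range L, (φ t (ω t) + φ t (ω t - e)) ^ r ≤
        2 ^ (r-1) * ∑ t ∈ Finset.range L, (φ t (ω t) ^ r + φ t (ω t - e) ^ r) := by
      rw [Finset.mul_sum]
      exact Finset.sum_le_sum fun t _ => NNReal.rpow_add_le_mul_rpow_add_rpow _ _ hr.le
    have a3 := a1.trans (mul_le_mul_right a2 C)
    rw [← mul_assoc] at a3
    have := ENNReal.coe_le_coe.2 a3
    simpa only [ENNReal.ofNNReal_finsetSum, ENNReal.coe_mul, ENNReal.coe_add] using this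
  refine (Ex_mono w s L h2).trans ?_
  rw [Ex_mul, Ex_sum]
  have h3 : ∀ t ∈ Finset.range L, Ex w s L (fun ω =>
      (((φ t (ω t) ^ r : ℝ≥0) : ℝ≥0∞) + ((φ t (ω t - e) ^ r : ℝ≥0) : ℝ≥0∞)))
      = 2 * ∑' x, ((φ t x ^ r : ℝ≥0) : ℝ≥0∞) := by
    intro t ht
    rw [Ex_dep w s hw hw1 t L (Finset.mem_range.1 ht).le _ (fun ω ω' h => by rw [h t le_rfl]),
      Ex_marg w s hw hw1 t (fun x => ((φ t x ^ r : ℝ≥0) : ℝ≥0∞) + ((φ t (x - e) ^ r : ℝ≥0) : ℝ≥0∞)),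
      ENNReal.tsum_add, two_mul]
    congr 1
    exact (Equiv.subRight e).tsum_eq (fun x => ((φ t x ^ r : ℝ≥0) : ℝ≥0∞))
  rw [Finset.sum_congr rfl h3, ← Finset.mul_sum, ← mul_assoc]
  have h4 : ((C * 2 ^ (r-1) : ℝ≥0) : ℝ≥0∞) * 2 = ((C * 2 ^ r : ℝ≥0) : ℝ≥0∞) := by
    have : (2:ℝ≥0) ^ r = 2 ^ (r-1) * 2 := by
      rw [← NNReal.rpow_add_one (by norm_num)]; congr 1; ring
    rw [this, ← mul_assoc, ENNReal.coe_mul (C * 2 ^ (r-1))]; simp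
  rw [h4]
  gcongr
  rw [ENNReal.tsum_prod']
  exact ENNReal.sum_le_tsum _

lemma Ss_ne_top (e : X) (u : ℕ → ℕ → X → ℝ) (L : ℕ) (z : ℕ × X) : Ss e u L z ≠ ⊤ := by
  refine ENNReal.sum_ne_top.2 fun i _ => ?_
  split_ifs <;> simp [Df, sq]

lemma core_two (hw : ∀ t ξ, 0 ≤ w t ξ) (hw1 : ∀ t, ∑ ξ, w t ξ = 1) (c : ℝ) (hc : 0 < c)
    (o k : Ξ) (ho : s o = 0) (hco : ∀ t, c ≤ w t o) (hck : ∀ t, c ≤ w t k)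
    (u : ℕ → ℕ → X → ℝ) (L : ℕ)
    (hu : ∀ i, ∀ t < i, ∀ x, u i t x = ∑ ξ, w t ξ * u i (t+1) (x + s ξ)) :
    ∑' z : ℕ × X, Ss (s k) u L z ≤ ENNReal.ofReal (16/c) *
      ∑ i ∈ Finset.range (L+1), ∑' x, sq (u i i x) := by
  have := key3 w s hw hw1 c hc o k ho hco hck u L hu (fun _ _ => 1)
  simp only [ENNReal.coe_one, one_mul] at this
  refine this.trans ?_
  rw [show 16/c = (8/c)*2 by ring, ENNReal.ofReal_mul (by positivity), mul_assoc]
  gcongr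
  rw [Finset.mul_sum]
  refine Finset.sum_le_sum fun i _ => ?_
  rw [← Ex_marg w s hw hw1 i (fun x => sq (u i i x)), ← Ex_mul]
  refine Ex_mono w s i fun ω => ?_
  gcongr
  have : mx (fun _ => (1:ℝ≥0) + 1) i ≤ 2 := by
    refine Finset.sup_le fun r hr => ?_
    have : (i - r : ℕ) ≠ 0 := by have := Finset.mem_range.1 hr; omega
    have : ((i - r : ℕ) : ℝ≥0) ≠ 0 := by exact_mod_cast this
    simp only [Finset.sum_const, Nat.card_Ico, nsmul_eq_mul]
    rw [mul_div_cancel_left₀ _ this]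
    norm_num
  refine (ENNReal.coe_le_coe.2 this).trans ?_
  simp

end path

lemma young1 (q r K ε : ℝ) (hr : 1 < r) (hq : q = r / (r-1)) (hK : 0 < K) (hε : 0 < ε)
    (a : ℝ≥0) (b : ℝ) :
    ENNReal.ofReal K * ((a : ℝ≥0∞) * sq b) ≤ ENNReal.ofReal ε * ((a ^ r : ℝ≥0) : ℝ≥0∞) +
      ENNReal.ofReal (K * (K/ε)^(q-1)) * sq b ^ q := by
  have hq1 : q - 1 = 1/(r-1) := by rw [hq]; field_simp [show r - 1 ≠ 0 by linarith]; ring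
  have hq0 : 0 < q - 1 := by
    rw [hq1]
    have : 0 < r - 1 := by linarith
    positivity
  have h := young0 q r K ε hr hq hK hε a (b^2) a.2 (sq_nonneg b)
  have h' := ENNReal.ofReal_le_ofReal h
  rw [ENNReal.ofReal_mul hK.le, ENNReal.ofReal_mul (NNReal.coe_nonneg a), ENNReal.ofReal_add (by positivity) (by positivity),
    ENNReal.ofReal_mul hε.le, ENNReal.ofReal_mul (by positivity), ENNReal.ofReal_coe_nnreal,
    ← NNReal.coe_rpow, ENNReal.ofReal_coe_nnreal,
    ← ENNReal.ofReal_rpow_of_nonneg (sq_nonneg b) (by linarith)] at h'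
  exact h'

theorem core (c q : ℝ) (hc : 0 < c) (hq : 1 ≤ q) : ∃ N : ℝ, 0 < N ∧
    ∀ (X Ξ : Type) [AddCommGroup X] [Fintype Ξ] (w : ℕ → Ξ → ℝ) (s : Ξ → X)
    (_ : ∀ t ξ, 0 ≤ w t ξ) (_ : ∀ t, ∑ ξ, w t ξ = 1)
    (o k : Ξ) (_ : s o = 0) (_ : ∀ t, c ≤ w t o) (_ : ∀ t, c ≤ w t k)
    (u : ℕ → ℕ → X → ℝ) (L : ℕ)
    (_ : ∀ i, ∀ t < i, ∀ x, u i t x = ∑ ξ, w t ξ * u i (t+1) (x + s ξ)),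
    ∑' z : ℕ × X, Ss (s k) u L z ^ q ≤ ENNReal.ofReal N *
      ∑ i ∈ Finset.range (L+1), ∑' x, sq (u i i x) ^ q := by
  rcases hq.eq_or_lt with h1 | h1
  · subst h1
    refine ⟨16/c, by positivity, ?_⟩
    intro X Ξ _ _ w s hw hw1 o k ho hco hck u L hu
    simpa using core_two w s hw hw1 c hc o k ho hco hck u L hu
  have hq0 : 0 < q - 1 := by linarith
  set r := q / (q-1) with hr
  have hr1' : r - 1 = 1/(q-1) := by rw [hr]; field_simp; ring
  have hr1 : 1 < r := by
    have : 0 < r - 1 := by rw [hr1']; positivity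
    linarith
  have hqr : q = r / (r-1) := by rw [hr1', hr]; field_simp
  have hqr' : (q-1) * r = q := by rw [hr]; field_simp
  obtain ⟨C, hC0, hC⟩ := strong r hr1
  have hA : (0:ℝ) < C * 2 ^ r := by positivity
  set ε : ℝ := (2 * (C * 2 ^ r))⁻¹ with hε
  have hε0 : 0 < ε := by positivity
  set D : ℝ := (8/c) * ((8/c)/ε)^(q-1) with hD
  have hD0 : 0 < D := by positivity
  refine ⟨2 * D, by positivity, ?_⟩
  intro X Ξ _ _ w s hw hw1 o k ho hco hck u L hu
  classical
  rw [ENNReal.tsum_eq_iSup_sum]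
  refine iSup_le fun F => ?_
  set S := Ss (s k) u L with hS
  set R := ∑ i ∈ Finset.range (L+1), ∑' x, sq (u i i x) ^ q with hR
  set φ : ℕ → X → ℝ≥0 := fun t x => if (t, x) ∈ F then (S (t,x)).toNNReal ^ (q-1) else 0 with hφ
  have hSc : ∀ z, ((S z).toNNReal : ℝ≥0∞) = S z := fun z => ENNReal.coe_toNNReal (Ss_ne_top _ _ _ _)
  set A := ∑ z ∈ F, S z ^ q with hAdef
  have hAtop : A ≠ ⊤ := ENNReal.sum_ne_top.2 fun z _ =>
    ENNReal.rpow_ne_top_of_nonneg (by linarith) (Ss_ne_top _ _ _ _)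
  have e1 : A ≤ ∑' z : ℕ × X, (φ z.1 z.2 : ℝ≥0∞) * S z := by
    refine le_trans (Finset.sum_le_sum fun z hz => ?_) (ENNReal.sum_le_tsum F)
    simp only [hφ, Prod.mk.eta, hz, if_true]
    rw [ENNReal.coe_rpow_of_nonneg _ hq0.le, hSc]
    apply le_of_eq
    conv_lhs => rw [show q = (q - 1) + 1 by ring, ENNReal.rpow_add_of_nonneg _ _ hq0.le zero_le_one,
      ENNReal.rpow_one]
  have e2 : ∑' z : ℕ × X, ((φ z.1 z.2 ^ r : ℝ≥0) : ℝ≥0∞) ≤ A := by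
    rw [tsum_eq_sum (s := F)]
    · refine Finset.sum_le_sum fun z hz => ?_
      simp only [hφ, Prod.mk.eta, hz, if_true]
      rw [← NNReal.rpow_mul, hqr', ENNReal.coe_rpow_of_nonneg _ (by linarith), hSc]
    · intro z hz
      simp [hφ, hz, show r ≠ 0 by linarith]
  have e3 := key3 w s hw hw1 c hc o k ho hco hck u L hu φ
  rw [Finset.mul_sum] at e3
  have e4 : A ≤ ENNReal.ofReal ε * (((C * 2 ^ r : ℝ≥0) : ℝ≥0∞) * A) + ENNReal.ofReal D * R := by
    refine (e1.trans e3).trans ?_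
    have : ∀ i ∈ Finset.range (L+1), ENNReal.ofReal (8/c) * Ex w s i (fun ω =>
        (mx (fun t => φ t (ω t) + φ t (ω t - s k)) i : ℝ≥0∞) * sq (u i i (ω i))) ≤
        ENNReal.ofReal ε * Ex w s i (fun ω =>
          ((mx (fun t => φ t (ω t) + φ t (ω t - s k)) i ^ r : ℝ≥0) : ℝ≥0∞)) +
        ENNReal.ofReal D * ∑' x, sq (u i i x) ^ q := by
      intro i _
      rw [← Ex_marg w s hw hw1 i (fun x => sq (u i i x) ^ q), ← Ex_mul, ← Ex_mul, ← Ex_mul, ← Ex_add]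
      exact Ex_mono w s i fun ω => young1 q r (8/c) ε hr1 hqr (by positivity) hε0 _ _
    refine (Finset.sum_le_sum this).trans ?_
    rw [Finset.sum_add_distrib, ← Finset.mul_sum, ← Finset.mul_sum]
    gcongr
    exact (mxb w s hw hw1 (s k) r hr1 C hC φ L).trans (by gcongr)
  have e5 : ENNReal.ofReal ε * (((C * 2 ^ r : ℝ≥0) : ℝ≥0∞) * A) = A / 2 := by
    rw [← mul_assoc, ← ENNReal.ofReal_coe_nnreal, ← ENNReal.ofReal_mul hε0.le, mul_comm, ENNReal.div_eq_inv_mul,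
      mul_comm]
    congr 1
    have : ε * ((C * 2 ^ r : ℝ≥0) : ℝ) = 2⁻¹ := by
      push_cast
      rw [hε]; field_simp
    rw [this, ENNReal.ofReal_inv_of_pos (by norm_num)]; simp
  rw [e5] at e4
  have e6 : A / 2 ≤ ENNReal.ofReal D * R := by
    have h2 : A / 2 ≠ ⊤ := (ENNReal.div_lt_top hAtop (by norm_num)).ne
    have : A / 2 + A / 2 ≤ A / 2 + ENNReal.ofReal D * R := by rwa [ENNReal.add_halves]
    exact (ENNReal.add_le_add_iff_left h2).1 this
  calc A = A/2 + A/2 := (ENNReal.add_halves A).symm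
    _ ≤ ENNReal.ofReal D * R + ENNReal.ofReal D * R := add_le_add e6 e6
    _ = _ := by rw [ENNReal.ofReal_mul (p := 2) (by norm_num), ENNReal.ofReal_ofNat]; ring

end DLP

end DLPaux

/-- Theorem 3.3: discrete parabolic Littlewood–Paley inequality. -/
theorem discrete_littlewood_paley
    (d d₁ : ℕ) (hd : 1 ≤ d) (hdd₁ : d ≤ d₁)
    (l : Fin d₁ → Fin d → ℤ) (hl : ∀ (k : Fin d₁) (hk : (k : ℕ) < d), l k = stdE d ⟨k, hk⟩)
    (δ₁ δ₂ : ℝ) (hδ₁ : 0 < δ₁) (hδ₁₂ : δ₁ ≤ δ₂)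
    (ρ : ℝ) (hρ : 0 < ρ) (hρ' : ρ < (2 * d₁ * δ₂)⁻¹)
    (p : ℝ) (hp : 2 ≤ p) :
    ∃ N : ℝ, 0 < N ∧
      ∀ lam : Fin d₁ → ℤ → ℝ, (∀ k t, lam k t ∈ Set.Icc δ₁ δ₂) →
      ∀ G : ℤ → ℤ → (Fin d → ℤ) → ℝ,
        (∀ (m : ℤ) (y : Fin d → ℤ), G m m y = if y = 0 then 1 else 0) →
        (∀ m nn : ℤ, m ≤ nn → ∀ y, G m (nn + 1) y =
          G m nn y + ρ * ∑ k, lam k nn * (G m nn (y + l k) - 2 * G m nn y + G m nn (y - l k))) →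
      ∀ g : ℤ → (Fin d → ℤ) → ℝ,
        (Function.support fun q : ℤ × (Fin d → ℤ) => g q.1 q.2).Finite →
        ∀ k : Fin d,
        ∑' nn : ℤ, ∑' x : Fin d → ℤ,
            (∑' j : ℤ, if j < nn then
                (ENNReal.ofReal
                  |∑' y : Fin d → ℤ, fdiff 1 (stdE d k) (G j nn) (x - y) * g j y|) ^ 2
              else 0) ^ (p / 2) ≤
          ENNReal.ofReal N * ∑' q : ℤ × (Fin d → ℤ), ENNReal.ofReal (|g q.1 q.2| ^ p) := by
  have hd₁ : (0:ℝ) < d₁ := by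
    have : 0 < d₁ := by omega
    exact_mod_cast this
  have hδ₂ : 0 < δ₂ := by linarith
  have hpos : 0 < 2 * d₁ * δ₂ := by positivity
  have hlt : ρ * (2 * d₁ * δ₂) < 1 := by
    have := mul_lt_mul_of_pos_right hρ' hpos
    rwa [inv_mul_cancel₀ hpos.ne'] at this
  set c : ℝ := min (1 - ρ * (2 * d₁ * δ₂)) (ρ * δ₁) with hcdef
  have hc : 0 < c := lt_min (by linarith) (by positivity)
  obtain ⟨N, hN, core⟩ := DLP.core c (p/2) hc (by linarith)
  refine ⟨N, hN, ?_⟩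
  intro lam hlam G hG0 hG1 g hg k
  classical
  set Sg := hg.toFinset with hSg
  set T := Sg.image Prod.snd with hT
  set v : ℤ → ℤ → (Fin d → ℤ) → ℝ := fun j n x => ∑ y ∈ T, G j n (x - y) * g j y with hv
  have hgT : ∀ j y, y ∉ T → g j y = 0 := by
    intro j y hy
    by_contra h
    exact hy (Finset.mem_image.2 ⟨(j, y), by simpa [hSg] using h, rfl⟩)
  have hv0 : ∀ j x, v j j x = g j x := by
    intro j x
    simp only [hv, hG0, sub_eq_zero, ite_mul, one_mul, zero_mul, Finset.sum_ite_eq]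
    split_ifs with h
    · rfl
    · exact (hgT j x h).symm
  have hv1 : ∀ j n, j ≤ n → ∀ x, v j (n+1) x =
      v j n x + ρ * ∑ k, lam k n * (v j n (x + l k) - 2 * v j n x + v j n (x - l k)) := by
    intro j n hjn x
    have e : ∀ k : Fin d₁, lam k n * (v j n (x + l k) - 2 * v j n x + v j n (x - l k)) =
        ∑ y ∈ T, lam k n * (G j n (x - y + l k) - 2 * G j n (x - y) + G j n (x - y - l k)) * g j y := by
      intro k
      simp only [hv, Finset.mul_sum, ← Finset.sum_add_distrib, ← Finset.sum_sub_distrib]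
      refine Finset.sum_congr rfl fun y _ => ?_
      rw [show x + l k - y = x - y + l k by abel, show x - l k - y = x - y - l k by abel]
      ring
    simp only [e]
    rw [Finset.sum_comm, Finset.mul_sum]
    simp only [hv]
    rw [← Finset.sum_add_distrib]
    refine Finset.sum_congr rfl fun y _ => ?_
    rw [hG1 j n hjn, ← Finset.sum_mul]
    ring
  have hterm : ∀ j n x, ENNReal.ofReal
      |∑' y : Fin d → ℤ, fdiff 1 (stdE d k) (G j n) (x - y) * g j y| ^ 2 =
      DLP.sq (v j n (x + stdE d k) - v j n x) := by
    intro j n x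
    rw [tsum_eq_sum (s := T) (fun y hy => by rw [hgT j y hy, mul_zero]), DLP.sq,
      ← ENNReal.ofReal_pow (abs_nonneg _), sq_abs]
    congr 2
    simp only [hv, ← Finset.sum_sub_distrib, fdiff, div_one]
    refine Finset.sum_congr rfl fun y _ => ?_
    rw [show x + stdE d k - y = x - y + stdE d k by abel]
    ring
  have hprod : ∀ f : ℤ → (Fin d → ℤ) → ℝ≥0∞, ∑' n, ∑' x, f n x = ∑' z : ℤ × (Fin d → ℤ), f z.1 z.2 :=
    fun f => (ENNReal.tsum_prod' (f := fun z : ℤ × (Fin d → ℤ) => f z.1 z.2)).symm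
  rw [hprod, ENNReal.tsum_eq_iSup_sum]
  refine iSup_le fun F => ?_
  obtain ⟨B, hB⟩ : ∃ B : ℤ, ∀ z ∈ F, z.1 ≤ B := by
    obtain ⟨B, hB⟩ := (F.image Prod.fst).bddAbove
    exact ⟨B, fun z hz => hB (by simpa using ⟨z.2, hz⟩)⟩
  obtain ⟨A, hA⟩ : ∃ A : ℤ, ∀ z ∈ Sg, A ≤ z.1 := by
    obtain ⟨B, hB⟩ := (Sg.image Prod.fst).bddBelow
    exact ⟨B, fun z hz => hB (by
      simp only [Finset.coe_image, Set.mem_image, Finset.mem_coe]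
      exact ⟨z, hz, rfl⟩)⟩
  have hgA : ∀ j y, j < A → g j y = 0 := by
    intro j y hj
    by_contra h
    have := hA (j, y) (by simpa [hSg] using h)
    simp only at this
    omega
  set L : ℕ := (B - A).toNat with hL
  set w : ℕ → Option (Fin d₁ × Bool) → ℝ := fun t ξ =>
    match ξ with
    | none => 1 - 2 * ρ * ∑ k, lam k (B - t - 1)
    | some (k, _) => ρ * lam k (B - t - 1) with hw
  set s : Option (Fin d₁ × Bool) → (Fin d → ℤ) := fun ξ =>
    match ξ with
    | none => 0
    | some (k, true) => l k
    | some (k, false) => - l k with hs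
  set k' : Fin d₁ := Fin.castLE hdd₁ k with hk'
  have hsk : s (some (k', true)) = stdE d k := by
    simp only [hs]
    exact hl k' k.2
  have hnone : ∀ t, c ≤ w t none := by
    intro t
    refine (min_le_left _ _).trans ?_
    simp only [hw]
    have : ∑ k, lam k (B - t - 1) ≤ d₁ * δ₂ := by
      refine (Finset.sum_le_sum fun k _ => (hlam k _).2).trans ?_
      simp
    nlinarith
  have hsome : ∀ t k b, c ≤ w t (some (k, b)) := by
    intro t k b
    refine (min_le_right _ _).trans ?_
    simp only [hw]
    have := (hlam k (B - t - 1)).1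
    gcongr
  have hw0 : ∀ t ξ, 0 ≤ w t ξ := by
    rintro t (_ | ⟨k, b⟩)
    · exact hc.le.trans (hnone t)
    · exact hc.le.trans (hsome t k b)
  have hw1 : ∀ t, ∑ ξ, w t ξ = 1 := by
    intro t
    simp only [Fintype.sum_option, Fintype.sum_prod_type, Fintype.sum_bool, hw, Finset.sum_add_distrib,
      ← Finset.mul_sum]
    ring
  have hu : ∀ i : ℕ, ∀ t < i, ∀ x, v (B - i) (B - t) x =
      ∑ ξ, w t ξ * v (B - i) (B - (t+1 : ℕ)) (x + s ξ) := by
    intro i t hti x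
    have := hv1 (B - i) (B - t - 1) (by omega) x
    rw [sub_add_cancel] at this
    rw [this, show B - ((t+1 : ℕ) : ℤ) = B - t - 1 by push_cast; ring]
    simp only [Fintype.sum_option, Fintype.sum_prod_type, Fintype.sum_bool, hw, hs, add_zero,
      ← sub_eq_add_neg]
    generalize v (B - i) (B - t - 1) = V
    have e : ∑ k, lam k (B - t - 1) * (V (x + l k) - 2 * V x + V (x - l k)) =
        ∑ k, lam k (B - t - 1) * (V (x + l k) + V (x - l k)) -
          2 * V x * ∑ k, lam k (B - t - 1) := by
      rw [Finset.mul_sum, ← Finset.sum_sub_distrib]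
      refine Finset.sum_congr rfl fun k _ => ?_
      ring
    have e2 : ∑ k, (ρ * lam k (B - t - 1) * V (x + l k) + ρ * lam k (B - t - 1) * V (x - l k)) =
        ρ * ∑ k, lam k (B - t - 1) * (V (x + l k) + V (x - l k)) := by
      rw [Finset.mul_sum]
      refine Finset.sum_congr rfl fun k _ => ?_
      ring
    rw [e, e2]
    ring
  have key := core (Fin d → ℤ) (Option (Fin d₁ × Bool)) w s hw0 hw1 none (some (k', true)) rfl hnone
    (fun t => hsome t k' true) (fun i t x => v (B - i) (B - t) x) L hu
  rw [hsk] at key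
  have hinj : ∀ S : Finset ℕ, Set.InjOn (fun i : ℕ => B - (i:ℤ)) S := by
    intro S a _ b _ h
    simp only at h
    omega
  have hL1 : ∀ z ∈ F, (∑' j : ℤ, if j < z.1 then
      (ENNReal.ofReal |∑' y : Fin d → ℤ, fdiff 1 (stdE d k) (G j z.1) (z.2 - y) * g j y|) ^ 2 else 0)
      = DLP.Ss (stdE d k) (fun i t x => v (B - i) (B - t) x) L ((B - z.1).toNat, z.2) := by
    rintro ⟨n, x⟩ hz
    have hn : n ≤ B := hB _ hz
    simp only [hterm]
    rw [tsum_eq_sum (s := (Finset.range (L+1)).image (fun i : ℕ => B - (i:ℤ)))]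
    · rw [Finset.sum_image (hinj _)]
      simp only [DLP.Ss, DLP.Df]
      refine Finset.sum_congr rfl fun i _ => ?_
      rw [show B - ((B - n).toNat : ℤ) = n by omega]
      refine if_congr (by omega) rfl rfl
    · intro j hj
      split_ifs with h
      · have hjA : j < A := by
          by_contra h'
          apply hj
          refine Finset.mem_image.2 ⟨(B - j).toNat, Finset.mem_range.2 (by omega), by omega⟩
        simp [hv, hgA j _ hjA, DLP.sq]
      · rfl
  rw [Finset.sum_congr rfl fun z hz => by rw [hL1 z hz]]
  have hinj2 : Set.InjOn (fun z : ℤ × (Fin d → ℤ) => ((B - z.1).toNat, z.2)) F := by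
    rintro ⟨n, x⟩ hz ⟨n', x'⟩ hz' h
    have h1 := hB _ hz
    have h2 := hB _ hz'
    simp only [Prod.mk.injEq] at h h1 h2 ⊢
    exact ⟨by omega, h.2⟩
  rw [← Finset.sum_image (f := fun z =>
    DLP.Ss (stdE d k) (fun i t x => v (B - i) (B - t) x) L z ^ (p/2)) hinj2]
  refine (ENNReal.sum_le_tsum _).trans (key.trans ?_)
  gcongr
  have hsq : ∀ a : ℝ, DLP.sq a ^ (p/2) = ENNReal.ofReal (|a| ^ p) := by
    intro a
    rw [DLP.sq, ENNReal.ofReal_rpow_of_nonneg (sq_nonneg _) (by linarith), ← sq_abs,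
      ← Real.rpow_natCast, ← Real.rpow_mul (abs_nonneg _)]
    congr 2
    push_cast
    ring
  simp only [hv0, hsq]
  rw [← hprod (fun j x => ENNReal.ofReal (|g j x| ^ p)),
    ← Finset.sum_image (f := fun j : ℤ => ∑' x, ENNReal.ofReal (|g j x| ^ p)) (hinj _)]
  exact ENNReal.sum_le_tsum _
end
end

section
/- (Littlewood–Paley inequality, p=2 case.) In the setting of the discrete heat kernel G, there is a constant N, depending only on d, d₁, δ₁*, δ₂*, the vectors l₁,…,l_{d₁} and ρ, such that for every finitely supported g : ℤ×ℤ^d→ℝ and every k∈{1,…,d}: Σ_{n∈ℤ} Σ_{x∈ℤ^d} Σ_{j=−∞}^{n−1} | (δ_{e_k}G(j,n,·)) ∗ g(j,·) (x) |² ≤ N Σ_{(j,x)∈ℤ×ℤ^d}|g(j,x)|². -/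
open scoped ENNReal BigOperators

noncomputable section

theorem lp_pointwise {ι : Type*} [Fintype ι] (w p q : ι → ℝ) (a c : ℝ) (hw : ∀ i, 0 ≤ w i)
    (hc : 0 ≤ c) (hW : 2 * ∑ i, w i ≤ 1 - c) (k : ι) :
    (a + ∑ i, w i * (p i - 2 * a + q i)) ^ 2 + c * w k * (p k - a) ^ 2 ≤
      (1 - 2 * ∑ i, w i) * a ^ 2 + ∑ i, w i * (p i ^ 2 + q i ^ 2) := by
  set W := ∑ i, w i with hWdef
  set B := ∑ i, w i * ((p i - a) ^ 2 + (q i - a) ^ 2) with hB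
  set T := ∑ i, w i * (p i - 2 * a + q i) with hT
  have hk : w k * (p k - a) ^ 2 ≤ B := by
    have h1 : w k * ((p k - a) ^ 2 + (q k - a) ^ 2) ≤ B :=
      Finset.single_le_sum (f := fun i => w i * ((p i - a) ^ 2 + (q i - a) ^ 2))
        (fun i _ => mul_nonneg (hw i) (by positivity)) (Finset.mem_univ k)
    have h2 := mul_nonneg (hw k) (sq_nonneg (q k - a))
    nlinarith
  have hB0 : 0 ≤ B := Finset.sum_nonneg (fun i _ => mul_nonneg (hw i) (by positivity))
  have hid : ∑ i, w i * (p i ^ 2 + q i ^ 2) = B + 2 * a * T + 2 * a ^ 2 * W := by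
    rw [hB, hT, hWdef, Finset.mul_sum, Finset.mul_sum, ← Finset.sum_add_distrib,
      ← Finset.sum_add_distrib]
    exact Finset.sum_congr rfl (fun i _ => by ring)
  have hCS : T ^ 2 ≤ W * ∑ i, w i * (p i - 2 * a + q i) ^ 2 := by
    refine Finset.sum_sq_le_sum_mul_sum_of_sq_eq_mul _ (fun i _ => hw i)
      (fun i _ => mul_nonneg (hw i) (sq_nonneg _)) (fun i _ => by ring)
  have h2 : ∑ i, w i * (p i - 2 * a + q i) ^ 2 ≤ 2 * B := by
    rw [hB, Finset.mul_sum]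
    refine Finset.sum_le_sum (fun i _ => ?_)
    nlinarith [mul_nonneg (hw i) (sq_nonneg (p i - q i))]
  have hW0 : 0 ≤ W := Finset.sum_nonneg (fun i _ => hw i)
  have h3 : T ^ 2 ≤ (1 - c) * B := by
    have := mul_le_mul_of_nonneg_left h2 hW0
    nlinarith
  rw [hid]
  have := mul_le_mul_of_nonneg_left hk hc
  nlinarith

theorem lp_step {d : ℕ} {ι : Type*} [Fintype ι] (l : ι → Fin d → ℤ) (w : ι → ℝ) (c κ : ℝ)
    (hw : ∀ i, 0 ≤ w i) (hc : 0 ≤ c) (hW : 2 * ∑ i, w i ≤ 1 - c) (k : ι)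
    (hκ : κ ≤ w k) (f f' : (Fin d → ℤ) → ℝ)
    (hf : ∀ x, f' x = f x + ∑ i, w i * (f (x + l i) - 2 * f x + f (x - l i))) :
    ∑' x, ENNReal.ofReal (f' x ^ 2) +
      ENNReal.ofReal (c * κ) * ∑' x, ENNReal.ofReal ((f (x + l k) - f x) ^ 2) ≤
      ∑' x, ENNReal.ofReal (f x ^ 2) := by
  set S := ∑' x, ENNReal.ofReal (f x ^ 2) with hS
  have hp : ∀ v : Fin d → ℤ, ∑' x, ENNReal.ofReal (f (x + v) ^ 2) = S := fun v =>
    (Equiv.addRight v).tsum_eq (fun x => ENNReal.ofReal (f x ^ 2))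
  have hm : ∀ v : Fin d → ℤ, ∑' x, ENNReal.ofReal (f (x - v) ^ 2) = S := fun v =>
    (Equiv.subRight v).tsum_eq (fun x => ENNReal.ofReal (f x ^ 2))
  have hW1 : 0 ≤ 1 - 2 * ∑ i, w i := by linarith
  have key : ∀ x, ENNReal.ofReal (f' x ^ 2) +
      ENNReal.ofReal (c * κ) * ENNReal.ofReal ((f (x + l k) - f x) ^ 2) ≤
      ENNReal.ofReal (1 - 2 * ∑ i, w i) * ENNReal.ofReal (f x ^ 2) +
      ∑ i, ENNReal.ofReal (w i) *
        (ENNReal.ofReal (f (x + l i) ^ 2) + ENNReal.ofReal (f (x - l i) ^ 2)) := by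
    intro x
    have h1 := lp_pointwise w (fun i => f (x + l i)) (fun i => f (x - l i)) (f x) c hw hc hW k
    rw [← hf x] at h1
    have h2 : ENNReal.ofReal (c * κ) ≤ ENNReal.ofReal (c * w k) :=
      ENNReal.ofReal_le_ofReal (mul_le_mul_of_nonneg_left hκ hc)
    calc _ ≤ ENNReal.ofReal (f' x ^ 2) +
          ENNReal.ofReal (c * w k) * ENNReal.ofReal ((f (x + l k) - f x) ^ 2) := by gcongr
      _ = ENNReal.ofReal (f' x ^ 2 + c * w k * (f (x + l k) - f x) ^ 2) := by
          rw [← ENNReal.ofReal_mul (mul_nonneg hc (hw k)), ENNReal.ofReal_add (sq_nonneg _)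
            (mul_nonneg (mul_nonneg hc (hw k)) (sq_nonneg _))]
      _ ≤ _ := ENNReal.ofReal_le_ofReal h1
      _ = _ := by
          rw [ENNReal.ofReal_add (mul_nonneg hW1 (sq_nonneg _))
            (Finset.sum_nonneg fun i _ => mul_nonneg (hw i) (by positivity)),
            ENNReal.ofReal_mul hW1,
            ENNReal.ofReal_sum_of_nonneg (fun i _ => mul_nonneg (hw i) (by positivity))]
          congr 1
          refine Finset.sum_congr rfl fun i _ => ?_
          rw [ENNReal.ofReal_mul (hw i), ENNReal.ofReal_add (sq_nonneg _) (sq_nonneg _)]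
  rw [← ENNReal.tsum_mul_left, ← ENNReal.tsum_add]
  refine (ENNReal.tsum_le_tsum key).trans ?_
  rw [ENNReal.tsum_add, ENNReal.tsum_mul_left, Summable.tsum_finsetSum (fun i _ => ENNReal.summable)]
  simp_rw [ENNReal.tsum_mul_left, ENNReal.tsum_add, hp, hm]
  rw [← hS, ← Finset.sum_mul, ← two_mul, ← ENNReal.ofReal_sum_of_nonneg (fun i _ => hw i), ← mul_assoc,
    ← add_mul]
  have : ENNReal.ofReal (1 - 2 * ∑ i, w i) + ENNReal.ofReal (∑ i, w i) * 2 = 1 := by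
    rw [← ENNReal.ofReal_ofNat 2, ← ENNReal.ofReal_mul (Finset.sum_nonneg fun i _ => hw i),
      ← ENNReal.ofReal_add hW1 (mul_nonneg (Finset.sum_nonneg fun i _ => hw i) (by norm_num))]
    rw [← ENNReal.ofReal_one]; congr 1; ring
  rw [this, one_mul]

theorem lp_tele (S D : ℕ → ℝ≥0∞) (K : ℝ≥0∞) (h : ∀ m, S (m + 1) + K * D m ≤ S m) :
    K * ∑' m, D m ≤ S 0 := by
  rw [← ENNReal.tsum_mul_left]
  refine ENNReal.tsum_le_of_sum_range_le fun M => ?_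
  have : S M + ∑ m ∈ Finset.range M, K * D m ≤ S 0 := by
    induction M with
    | zero => simp
    | succ M ih =>
      rw [Finset.sum_range_succ]
      calc _ = (S (M + 1) + K * D M) + ∑ m ∈ Finset.range M, K * D m := by ring
        _ ≤ S M + ∑ m ∈ Finset.range M, K * D m := by gcongr; exact h M
        _ ≤ _ := ih
  exact le_add_self.trans this

theorem lp_shift (j : ℤ) (F : ℤ → ℝ≥0∞) :
    ∑' n : ℤ, (if j < n then F n else 0) ≤ ∑' m : ℕ, F (j + m) := by
  have h0 : ∀ n : ℤ, (if j < n then F n else 0) ≤ (if j ≤ n then F n else 0) := by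
    intro n
    split_ifs with h1 h2
    · rfl
    · omega
    · exact zero_le
    · rfl
  refine (ENNReal.tsum_le_tsum h0).trans (le_of_eq ?_)
  have hinj : Function.Injective (fun m : ℕ => j + (m : ℤ)) := fun a b h => by
    simpa using h
  rw [← hinj.tsum_eq (f := fun n : ℤ => if j ≤ n then F n else 0)]
  · exact tsum_congr fun m => by simp
  · intro n hn
    have : j ≤ n := by
      by_contra h
      simp [h] at hn
    exact ⟨(n - j).toNat, by simp only; omega⟩

/-- Lemma 5.1: Littlewood–Paley inequality, `p = 2` case. -/
theorem discrete_littlewood_paley_p_two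
    (d d₁ : ℕ) (hd : 1 ≤ d) (hdd₁ : d ≤ d₁)
    (l : Fin d₁ → Fin d → ℤ) (hl : ∀ (k : Fin d₁) (hk : (k : ℕ) < d), l k = stdE d ⟨k, hk⟩)
    (δ₁ δ₂ : ℝ) (hδ₁ : 0 < δ₁) (hδ₁₂ : δ₁ ≤ δ₂)
    (ρ : ℝ) (hρ : 0 < ρ) (hρ' : ρ < (2 * d₁ * δ₂)⁻¹) :
    ∃ N : ℝ, 0 < N ∧
      ∀ lam : Fin d₁ → ℤ → ℝ, (∀ k t, lam k t ∈ Set.Icc δ₁ δ₂) →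
      ∀ G : ℤ → ℤ → (Fin d → ℤ) → ℝ,
        (∀ (m : ℤ) (y : Fin d → ℤ), G m m y = if y = 0 then 1 else 0) →
        (∀ m nn : ℤ, m ≤ nn → ∀ y, G m (nn + 1) y =
          G m nn y + ρ * ∑ k, lam k nn * (G m nn (y + l k) - 2 * G m nn y + G m nn (y - l k))) →
      ∀ g : ℤ → (Fin d → ℤ) → ℝ,
        (Function.support fun q : ℤ × (Fin d → ℤ) => g q.1 q.2).Finite →
        ∀ k : Fin d,
        ∑' nn : ℤ, ∑' x : Fin d → ℤ, ∑' j : ℤ,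
            (if j < nn then
              (ENNReal.ofReal
                |∑' y : Fin d → ℤ, fdiff 1 (stdE d k) (G j nn) (x - y) * g j y|) ^ 2
            else 0) ≤
          ENNReal.ofReal N * ∑' q : ℤ × (Fin d → ℤ), ENNReal.ofReal (|g q.1 q.2| ^ 2) := by
  have hδ₂ : 0 < δ₂ := hδ₁.trans_le hδ₁₂
  have hd₁ : (0:ℝ) < d₁ := by exact_mod_cast (by omega : 0 < d₁)
  have hc : 0 < 1 - 2 * d₁ * δ₂ * ρ := by
    have hpos : 0 < 2 * d₁ * δ₂ := by positivity
    have := mul_lt_mul_of_pos_left hρ' hpos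
    rw [mul_inv_cancel₀ hpos.ne'] at this
    linarith
  set c := 1 - 2 * d₁ * δ₂ * ρ with hcdef
  have hK : 0 < c * (ρ * δ₁) := by positivity
  refine ⟨(c * (ρ * δ₁))⁻¹, inv_pos.2 hK, ?_⟩
  intro lam hlam G hG0 hG1 g hg k
  have hk1 : (k : ℕ) < d₁ := lt_of_lt_of_le k.2 hdd₁
  have hlk : l ⟨k, hk1⟩ = stdE d k := hl ⟨k, hk1⟩ k.2
  have hfin : ∀ j, ∃ s : Finset (Fin d → ℤ), ∀ y, y ∉ s → g j y = 0 := by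
    intro j
    refine ⟨(hg.image Prod.snd).toFinset, fun y hy => ?_⟩
    by_contra h
    exact hy (by
      rw [Set.Finite.mem_toFinset]
      exact ⟨(j, y), h, rfl⟩)
  choose s hs using hfin
  let u : ℤ → ℤ → (Fin d → ℤ) → ℝ := fun j n x => ∑ y ∈ s j, G j n (x - y) * g j y
  have hu0 : ∀ j x, u j j x = g j x := by
    intro j x
    simp only [u, hG0, sub_eq_zero, ite_mul, one_mul, zero_mul]
    rw [Finset.sum_ite_eq]
    split_ifs with h
    · rfl
    · exact (hs j x h).symm
  have hu1 : ∀ j n, j ≤ n → ∀ x, u j (n + 1) x = u j n x +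
      ∑ i, (ρ * lam i n) * (u j n (x + l i) - 2 * u j n x + u j n (x - l i)) := by
    intro j n hjn x
    simp only [u]
    have : ∀ i, (ρ * lam i n) * ((∑ y ∈ s j, G j n (x + l i - y) * g j y)
        - 2 * (∑ y ∈ s j, G j n (x - y) * g j y) + ∑ y ∈ s j, G j n (x - l i - y) * g j y)
        = ∑ y ∈ s j, (ρ * lam i n) * (G j n (x - y + l i) - 2 * G j n (x - y)
          + G j n (x - y - l i)) * g j y := by
      intro i
      rw [Finset.mul_sum, ← Finset.sum_sub_distrib, ← Finset.sum_add_distrib, Finset.mul_sum]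
      refine Finset.sum_congr rfl fun y _ => ?_
      rw [show x + l i - y = x - y + l i by abel, show x - l i - y = x - y - l i by abel]
      ring
    simp_rw [this]
    rw [Finset.sum_comm, ← Finset.sum_add_distrib]
    refine Finset.sum_congr rfl fun y _ => ?_
    rw [hG1 j n hjn, ← Finset.sum_mul, Finset.mul_sum, add_mul]
    simp only [mul_assoc]
  have hconv : ∀ j n x, ∑' y, fdiff 1 (stdE d k) (G j n) (x - y) * g j y =
      u j n (x + stdE d k) - u j n x := by
    intro j n x
    rw [tsum_eq_sum (s := s j) (fun y hy => by rw [hs j y hy, mul_zero])]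
    simp only [u, fdiff, div_one]
    rw [← Finset.sum_sub_distrib]
    refine Finset.sum_congr rfl fun y _ => ?_
    rw [show x + stdE d k - y = x - y + stdE d k by abel]
    ring
  have hsq : ∀ a : ℝ, ENNReal.ofReal |a| ^ 2 = ENNReal.ofReal (a ^ 2) := by
    intro a
    rw [← ENNReal.ofReal_pow (abs_nonneg a), sq_abs]
  simp_rw [hconv, hsq, sq_abs]
  have hj : ∀ j : ℤ, ∑' n : ℤ, ∑' x : Fin d → ℤ,
      (if j < n then ENNReal.ofReal ((u j n (x + stdE d k) - u j n x) ^ 2) else 0) ≤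
      ENNReal.ofReal (c * (ρ * δ₁))⁻¹ * ∑' x, ENNReal.ofReal (g j x ^ 2) := by
    intro j
    have e : ∀ n : ℤ, ∑' x : Fin d → ℤ,
        (if j < n then ENNReal.ofReal ((u j n (x + stdE d k) - u j n x) ^ 2) else 0) =
        if j < n then ∑' x : Fin d → ℤ, ENNReal.ofReal ((u j n (x + stdE d k) - u j n x) ^ 2)
          else 0 := by
      intro n
      split_ifs <;> simp
    simp_rw [e]
    refine (lp_shift j _).trans ?_
    have ht := lp_tele (fun m => ∑' x, ENNReal.ofReal (u j (j + m) x ^ 2))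
      (fun m => ∑' x, ENNReal.ofReal ((u j (j + m) (x + stdE d k) - u j (j + m) x) ^ 2))
      (ENNReal.ofReal (c * (ρ * δ₁))) (by
        intro m
        have hst := lp_step l (fun i => ρ * lam i (j + m)) c (ρ * δ₁)
          (fun i => mul_nonneg hρ.le (hδ₁.le.trans (hlam i _).1)) hc.le (by
            rw [← Finset.mul_sum]
            have : ∑ i, lam i (j + m) ≤ d₁ * δ₂ := by
              refine (Finset.sum_le_sum fun i _ => (hlam i (j + m)).2).trans ?_
              simp
            have := mul_le_mul_of_nonneg_left this hρ.le
            rw [hcdef]; linarith) ⟨k, hk1⟩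
          (mul_le_mul_of_nonneg_left (hlam _ _).1 hρ.le) (u j (j + m)) (u j (j + m + 1))
          (hu1 j (j + m) (by omega))
        rw [hlk] at hst
        simpa [add_assoc] using hst)
    simp only [Nat.cast_zero, add_zero, hu0] at ht
    rw [ENNReal.ofReal_inv_of_pos hK]
    rw [← ENNReal.div_eq_inv_mul, ENNReal.le_div_iff_mul_le (Or.inl (by simpa using hK))
      (Or.inl ENNReal.ofReal_ne_top), mul_comm]
    exact ht
  calc _ = ∑' j : ℤ, ∑' n : ℤ, ∑' x : Fin d → ℤ,
      (if j < n then ENNReal.ofReal ((u j n (x + stdE d k) - u j n x) ^ 2) else 0) := by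
        refine Eq.trans (tsum_congr fun n => ?_) ENNReal.tsum_comm
        exact ENNReal.tsum_comm
    _ ≤ _ := ENNReal.tsum_le_tsum hj
    _ = _ := by
        rw [ENNReal.tsum_mul_left, ENNReal.tsum_prod']
end
end

section
/- (Calderón–Zygmund estimate, p=2 case.) In the setting of the discrete heat kernel G, there is a constant N, depending only on d, d₁, δ₁*, δ₂*, the vectors l₁,…,l_{d₁} and ρ, such that for every finitely supported f : ℤ×ℤ^d→ℝ one has Σ_{n∈ℤ} ( [ Σ_{j=−∞}^{n−1} G(j,n,·)∗f(j,·) ]_{2,2;1} )² ≤ N Σ_{(j,x)∈ℤ×ℤ^d}|f(j,x)|². -/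
open scoped ENNReal BigOperators

noncomputable section

section Abstract
variable {R : Type*} [CommRing R] [Algebra ℝ R]

inductive SPos (σ : R →ₐ[ℝ] R) : R → Prop
  | sq (q : R) : SPos σ (q * σ q)
  | add (a b : R) : SPos σ a → SPos σ b → SPos σ (a + b)

theorem SPos.zero (σ : R →ₐ[ℝ] R) : SPos σ 0 := by
  simpa using SPos.sq (σ := σ) 0

theorem SPos.one (σ : R →ₐ[ℝ] R) : SPos σ 1 := by
  simpa using SPos.sq (σ := σ) 1

theorem SPos.sum {σ : R →ₐ[ℝ] R} {ι : Type*} (s : Finset ι) (f : ι → R)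
    (h : ∀ i ∈ s, SPos σ (f i)) : SPos σ (∑ i ∈ s, f i) := by
  classical
  induction s using Finset.induction_on with
  | empty => simpa using SPos.zero σ
  | insert a s ha ih =>
    rw [Finset.sum_insert ha]
    exact SPos.add _ _ (h a (by simp)) (ih fun i hi => h i (by simp [hi]))

theorem SPos.smul {σ : R →ₐ[ℝ] R} {a : R} (c : ℝ) (hc : 0 ≤ c) (h : SPos σ a) :
    SPos σ (c • a) := by
  induction h with
  | sq q =>
    have : c • (q * σ q) = (Real.sqrt c • q) * σ (Real.sqrt c • q) := by
      rw [map_smul, smul_mul_smul_comm, Real.mul_self_sqrt hc]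
    rw [this]; exact SPos.sq _
  | add a b _ _ iha ihb => rw [smul_add]; exact SPos.add _ _ iha ihb

theorem SPos.mul {σ : R →ₐ[ℝ] R} {a b : R} (ha : SPos σ a) (hb : SPos σ b) :
    SPos σ (a * b) := by
  induction ha with
  | sq q =>
    induction hb with
    | sq r =>
      have : q * σ q * (r * σ r) = (q * r) * σ (q * r) := by rw [map_mul]; ring
      rw [this]; exact SPos.sq _
    | add a b _ _ iha ihb => rw [mul_add]; exact SPos.add _ _ iha ihb
  | add a b _ _ iha ihb => rw [add_mul]; exact SPos.add _ _ iha ihb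

theorem SPos.pos {σ : R →ₐ[ℝ] R} (τ : R →ₗ[ℝ] ℝ) (hτ : ∀ q, 0 ≤ τ (q * σ q)) {a : R}
    (ha : SPos σ a) : 0 ≤ τ a := by
  induction ha with
  | sq q => exact hτ q
  | add a b _ _ iha ihb => rw [map_add]; exact add_nonneg iha ihb

theorem SPos.pow_sub {σ : R →ₐ[ℝ] R} {a b : R} (ha : SPos σ a) (hab : SPos σ (b - a)) (n : ℕ) :
    SPos σ (a ^ n) ∧ SPos σ (b ^ n - a ^ n) := by
  have hb : SPos σ b := by simpa using SPos.add _ _ hab ha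
  induction n with
  | zero => simpa using ⟨SPos.one σ, SPos.zero σ⟩
  | succ n ih =>
    refine ⟨by rw [pow_succ]; exact ih.1.mul ha, ?_⟩
    have : b ^ (n+1) - a ^ (n+1) = (b ^ n - a ^ n) * b + a ^ n * (b - a) := by ring
    rw [this]
    exact SPos.add _ _ (ih.2.mul hb) (ih.1.mul hab)

theorem SPos.prod_sub {σ : R →ₐ[ℝ] R} {ι : Type*} (s : Finset ι) (a b : ι → R)
    (ha : ∀ i ∈ s, SPos σ (a i)) (hab : ∀ i ∈ s, SPos σ (b i - a i)) :
    SPos σ (∏ i ∈ s, a i) ∧ SPos σ (∏ i ∈ s, b i - ∏ i ∈ s, a i) := by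
  classical
  induction s using Finset.induction_on with
  | empty => simpa using ⟨SPos.one σ, SPos.zero σ⟩
  | insert j s hj ih =>
    rw [Finset.prod_insert hj, Finset.prod_insert hj]
    have h1 := ha j (by simp)
    have h2 := hab j (by simp)
    obtain ⟨h3, h4⟩ := ih (fun i hi => ha i (by simp [hi])) (fun i hi => hab i (by simp [hi]))
    have h5 : SPos σ (∏ i ∈ s, b i) := by simpa using SPos.add _ _ h4 h3
    refine ⟨h1.mul h3, ?_⟩
    have : b j * ∏ i ∈ s, b i - a j * ∏ i ∈ s, a i
      = (b j - a j) * ∏ i ∈ s, b i + a j * (∏ i ∈ s, b i - ∏ i ∈ s, a i) := by ring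
    rw [this]
    exact SPos.add _ _ (h2.mul h5) (h1.mul h4)

theorem energy_step (σ : R →ₐ[ℝ] R) (hσ : ∀ q, σ (σ q) = q) (τ : R →ₗ[ℝ] ℝ)
    (hτ : ∀ q, 0 ≤ τ (q * σ q)) (L P : R) (hL : σ L = L) (hP : σ P = P)
    (θ κ M : ℝ) (hθ : θ < 1) (hκ : 0 < κ)
    (pL : SPos σ L) (pP : SPos σ P) (pθ : SPos σ ((2 * θ) • (1 : R) - P))
    (pκ : SPos σ (P - κ • L)) (pM : SPos σ (M • (1 : R) - L)) (u f : R)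
    (c : ℝ) (hc : c = 2 * (1 - θ) * κ) :
    τ (L * (((1 - P) * (u + f)) * σ ((1 - P) * (u + f)))) + c / 4 * τ (L * L * (u * σ u)) ≤
      τ (L * (u * σ u)) + (2 / c + c / 2 * M ^ 2) * τ (f * σ f) := by
  have hc0 : 0 < c := by rw [hc]; have : 0 < 1 - θ := by linarith
                         positivity
  obtain ⟨v, hv⟩ : ∃ v, v = u + f := ⟨_, rfl⟩
  have hu : u = v - f := by rw [hv]; ring
  have key : SPos σ (L - L * ((1 - P) * (1 - P)) - c • (L * L)) := by
    have e : L - L * ((1 - P) * (1 - P)) - c • (L * L)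
      = L * (P * ((2 * θ) • (1 : R) - P)) + (2 * (1 - θ)) • (L * (P - κ • L)) := by
      subst hc
      simp only [Algebra.smul_def, map_mul, map_sub, map_one, map_ofNat]
      ring
    rw [e]
    exact SPos.add _ _ (pL.mul (pP.mul pθ)) ((pL.mul pκ).smul _ (by linarith))
  have h1 := (key.mul (SPos.sq v)).pos τ hτ
  have h2 := hτ ((c / 2) • (L * v) - f)
  have h3 := hτ (L * v + L * f)
  have h5 := (pL.mul (SPos.sq f)).pos τ hτ
  have pM2 : SPos σ ((M ^ 2) • (1 : R) - L * L) := by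
    have := (SPos.pow_sub pL pM 2).2
    have e : (M ^ 2) • (1 : R) - L * L = (M • (1:R)) ^ 2 - L ^ 2 := by
      simp only [Algebra.smul_def, map_pow]; ring
    rw [e]; exact this
  have h6 := (pM2.mul (SPos.sq f)).pos τ hτ
  have e1 : (L - L * ((1 - P) * (1 - P)) - c • (L * L)) * (v * σ v) =
      L * (v * σ v) - L * (((1 - P) * v) * σ ((1 - P) * v)) - c • (L * L * (v * σ v)) := by
    simp only [Algebra.smul_def, map_mul, map_sub, map_one, hP]; ring
  have e2 : ((c / 2) • (L * v) - f) * σ ((c / 2) • (L * v) - f) =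
      (c / 2) ^ 2 • (L * L * (v * σ v)) - (c / 2) • (L * (v * σ f + f * σ v)) + f * σ f := by
    simp only [map_mul, map_sub, map_smul, hL]
    simp only [Algebra.smul_def, map_pow]; ring
  have e3 : (L * v + L * f) * σ (L * v + L * f) =
      L * L * (v * σ v) + L * L * (v * σ f + f * σ v) + L * L * (f * σ f) := by
    simp only [map_mul, map_add, hL]; ring
  have e4 : L * (u * σ u) = L * (v * σ v) - L * (v * σ f + f * σ v) + L * (f * σ f) := by
    rw [hu, map_sub]; ring
  have e5 : L * L * (u * σ u) =
      L * L * (v * σ v) - L * L * (v * σ f + f * σ v) + L * L * (f * σ f) := by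
    rw [hu, map_sub]; ring
  have e6 : ((M ^ 2) • (1 : R) - L * L) * (f * σ f) = (M ^ 2) • (f * σ f) - L * L * (f * σ f) := by
    simp only [Algebra.smul_def]; ring
  rw [e1] at h1
  rw [e2] at h2
  rw [e3] at h3
  rw [e6] at h6
  rw [← hv, e4, e5]
  simp only [map_add, map_sub, map_smul, smul_eq_mul] at h1 h2 h3 h5 h6 ⊢
  generalize τ (L * (((1 - P) * v) * σ ((1 - P) * v))) = A' at *
  simp only [mul_add, map_add] at *
  generalize τ (L * (v * σ v)) = Av at *
  generalize τ (L * L * (v * σ v)) = Bv at *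
  generalize τ (L * L * (f * σ f)) = Bf at *
  generalize τ (f * σ f) = F at *
  generalize τ (L * (f * σ f)) = Af at *
  generalize τ (L * (v * σ f)) = X1 at *
  generalize τ (L * (f * σ v)) = X2 at *
  generalize τ (L * L * (v * σ f)) = Y1 at *
  generalize τ (L * L * (f * σ v)) = Y2 at *
  have h2' : X1 + X2 ≤ c / 2 * Bv + 2 / c * F := by
    have := mul_nonneg (by positivity : 0 ≤ 2 / c) h2
    have e : 2 / c * ((c / 2) ^ 2 * Bv - (c / 2 * X1 + c / 2 * X2) + F)
      = c / 2 * Bv + 2 / c * F - (X1 + X2) := by field_simp; ring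
    linarith
  nlinarith [mul_nonneg hc0.le h3, mul_nonneg hc0.le h6]

theorem energy_sum (σ : R →ₐ[ℝ] R) (hσ : ∀ q, σ (σ q) = q) (τ : R →ₗ[ℝ] ℝ)
    (hτ : ∀ q, 0 ≤ τ (q * σ q)) (L : R) (P : ℕ → R) (hL : σ L = L) (hP : ∀ n, σ (P n) = P n)
    (θ κ M : ℝ) (hθ : θ < 1) (hκ : 0 < κ)
    (pL : SPos σ L) (pP : ∀ n, SPos σ (P n)) (pθ : ∀ n, SPos σ ((2 * θ) • (1 : R) - P n))
    (pκ : ∀ n, SPos σ (P n - κ • L)) (pM : SPos σ (M • (1 : R) - L)) (u f : ℕ → R)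
    (u0 : u 0 = 0) (hu : ∀ n, u (n + 1) = (1 - P n) * (u n + f n))
    (c : ℝ) (hc : c = 2 * (1 - θ) * κ) (n : ℕ) :
    ∑ i ∈ Finset.range n, τ (L * L * (u i * σ (u i))) ≤
      4 / c * (2 / c + c / 2 * M ^ 2) * ∑ i ∈ Finset.range n, τ (f i * σ (f i)) := by
  have hc0 : 0 < c := by rw [hc]; have : 0 < 1 - θ := by linarith
                         positivity
  have main : τ (L * (u n * σ (u n))) + c / 4 * ∑ i ∈ Finset.range n, τ (L * L * (u i * σ (u i)))
      ≤ (2 / c + c / 2 * M ^ 2) * ∑ i ∈ Finset.range n, τ (f i * σ (f i)) := by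
    induction n with
    | zero => simp [u0]
    | succ n ih =>
      rw [Finset.sum_range_succ, Finset.sum_range_succ, hu n]
      have := energy_step σ hσ τ hτ L (P n) hL (hP n) θ κ M hθ hκ pL (pP n) (pθ n) (pκ n) pM
        (u n) (f n) c hc
      linarith
  have h0 := (pL.mul (SPos.sq (u n))).pos τ hτ
  have := mul_le_mul_of_nonneg_left (le_trans (le_add_of_nonneg_left h0) main)
    (by positivity : 0 ≤ 4 / c)
  rw [← mul_assoc, ← mul_assoc] at this
  rwa [show 4 / c * (c / 4) = 1 by field_simp, one_mul] at this

end Abstract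

section Concrete
open AddMonoidAlgebra
variable {d : ℕ}

abbrev RA (d : ℕ) := AddMonoidAlgebra ℝ (Fin d → ℤ)

def TT (ξ : Fin d → ℤ) : RA d := AddMonoidAlgebra.single ξ (1 : ℝ)

def sg : RA d →ₐ[ℝ] RA d :=
  AddMonoidAlgebra.mapDomainAlgHom ℝ ℝ (-(AddMonoidHom.id (Fin d → ℤ)))

theorem sg_single (x : Fin d → ℤ) (r : ℝ) : sg (single x r : RA d) = single (-x) r := by
  simp [sg]

theorem sg_TT (x : Fin d → ℤ) : sg (TT x) = TT (-x) := sg_single _ _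

theorem sg_coeff (q : RA d) (x : Fin d → ℤ) : (sg q).coeff x = q.coeff (-x) := by
  induction q using AddMonoidAlgebra.induction_linear with
  | zero => simp
  | add a b ha hb => simp [ha, hb]
  | single a r =>
    rw [sg_single]
    simp [Finsupp.single_apply, neg_eq_iff_eq_neg]

theorem sg_sg (q : RA d) : sg (sg q) = q := by
  ext x; simp [sg_coeff]

theorem TT_mul (x y : Fin d → ℤ) : TT x * TT y = TT (x + y) := by
  simp [TT, single_mul_single]

theorem TT_zero : TT (0 : Fin d → ℤ) = 1 := rfl

theorem TT_mul_coeff (ξ : Fin d → ℤ) (q : RA d) (x : Fin d → ℤ) :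
    (TT ξ * q).coeff x = q.coeff (x - ξ) := by
  rw [TT, coeff_single_mul_apply, one_mul]; congr 1; abel

def ta : RA d →ₗ[ℝ] ℝ where
  toFun q := q.coeff 0
  map_add' a b := by simp
  map_smul' c a := by simp

theorem ta_sq (q : RA d) : ta (q * sg q) = ∑ x ∈ q.coeff.support, q.coeff x ^ 2 := by
  change (q * sg q).coeff 0 = _
  rw [coeff_mul_apply_left, Finsupp.sum]
  refine Finset.sum_congr rfl fun x _ => ?_
  rw [sg_coeff]; simp [sq]

theorem ta_nonneg (q : RA d) : 0 ≤ ta (q * sg q) := by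
  rw [ta_sq]; positivity

theorem ta_tsum (q : RA d) :
    ∑' x, ENNReal.ofReal (|q.coeff x| ^ (2 : ℝ)) = ENNReal.ofReal (ta (q * sg q)) := by
  rw [ta_sq, ENNReal.ofReal_sum_of_nonneg (fun _ _ => sq_nonneg _), tsum_eq_sum]
  · refine Finset.sum_congr rfl fun x _ => ?_
    rw [Real.rpow_two, sq_abs]
  · intro x hx
    have : q.coeff x = 0 := by simpa using hx
    simp [this]

def DD (ξ : Fin d → ℤ) : RA d := TT (-ξ) - 1
def SS (ξ : Fin d → ℤ) : RA d := DD ξ * sg (DD ξ)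

theorem SS_eq (ξ : Fin d → ℤ) : SS ξ = 2 - TT ξ - TT (-ξ) := by
  have : TT (-ξ) * TT ξ = 1 := by rw [TT_mul]; simp [TT_zero]
  simp only [SS, DD, map_sub, map_one, sg_TT, neg_neg]
  linear_combination this

theorem sg_SS (ξ : Fin d → ℤ) : sg (SS ξ) = SS ξ := by
  rw [SS, map_mul, sg_sg, mul_comm]

theorem SS_pos (ξ : Fin d → ℤ) : SPos sg (SS ξ) := SPos.sq _

theorem four_sub_SS (ξ : Fin d → ℤ) : SPos sg ((4 : ℝ) • (1 : RA d) - SS ξ) := by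
  have : TT (-ξ) * TT ξ = 1 := by rw [TT_mul]; simp [TT_zero]
  have e : (4 : ℝ) • (1 : RA d) - SS ξ = (TT ξ + 1) * sg (TT ξ + 1) := by
    rw [SS_eq, Algebra.smul_def, map_add, map_one, sg_TT, map_ofNat]
    linear_combination -this
  rw [e]; exact SPos.sq _

theorem SS_mul_coeff (ξ : Fin d → ℤ) (q : RA d) (x : Fin d → ℤ) :
    (SS ξ * q).coeff x = 2 * q.coeff x - q.coeff (x - ξ) - q.coeff (x + ξ) := by
  have e : SS ξ * q = (2 : ℝ) • q - TT ξ * q - TT (-ξ) * q := by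
    rw [SS_eq, Algebra.smul_def, map_ofNat]; ring
  rw [e]; simp [TT_mul_coeff]

theorem fdiff_coeff (ξ : Fin d → ℤ) (q : RA d) :
    fdiff 1 ξ (fun x => q.coeff x) = fun x => (DD ξ * q).coeff x := by
  funext x
  simp [fdiff, DD, sub_mul, TT_mul_coeff]

theorem fdiff_iter (ξ : Fin d → ℤ) (n : ℕ) (q : RA d) :
    (fdiff 1 ξ)^[n] (fun x => q.coeff x) = fun x => (DD ξ ^ n * q).coeff x := by
  induction n with
  | zero => simp
  | succ n ih =>
    rw [Function.iterate_succ_apply', ih, fdiff_coeff]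
    funext x; rw [pow_succ', mul_assoc]

theorem mdiff_coeff (α : Fin d → ℕ) (q : RA d) :
    mdiff 1 α (fun x => q.coeff x) = fun x => ((∏ i, DD (stdE d i) ^ α i) * q).coeff x := by
  have : ∀ s : List (Fin d),
      s.foldr (fun i g => (fdiff 1 (stdE d i))^[α i] g) (fun x => q.coeff x)
        = fun x => ((s.map fun i => DD (stdE d i) ^ α i).prod * q).coeff x := by
    intro s
    induction s with
    | nil => simp
    | cons a s ih =>
      rw [List.foldr_cons, ih, fdiff_iter]
      funext x; rw [List.map_cons, List.prod_cons, mul_assoc]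
  rw [mdiff, this, ← List.ofFn_eq_map, List.prod_ofFn]

def LL (d : ℕ) : RA d := ∑ i, SS (stdE d i)

theorem sg_LL : sg (LL d) = LL d := by simp [LL, sg_SS]

theorem LL_pos : SPos sg (LL d) := SPos.sum _ _ fun _ _ => SS_pos _

theorem LL_le : SPos sg ((4 * d : ℝ) • (1 : RA d) - LL d) := by
  have e : (4 * d : ℝ) • (1 : RA d) - LL d = ∑ i, ((4 : ℝ) • (1 : RA d) - SS (stdE d i)) := by
    rw [Finset.sum_sub_distrib, LL]
    simp only [Finset.sum_const, Finset.card_univ, Fintype.card_fin]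
    rw [← Nat.cast_smul_eq_nsmul ℝ, smul_smul, mul_comm]
  rw [e]; exact SPos.sum _ _ fun _ _ => four_sub_SS _

theorem LL_sub (i : Fin d) : SPos sg (LL d - SS (stdE d i)) := by
  rw [LL, ← Finset.add_sum_erase _ _ (Finset.mem_univ i), add_sub_cancel_left]
  exact SPos.sum _ _ fun _ _ => SS_pos _

theorem mdiff_bound (α : Fin d → ℕ) (hα : ∑ i, α i = 2) (q : RA d) :
    lpN 2 1 (mdiff 1 α (fun x => q.coeff x)) ≤
      ENNReal.ofReal (ta (LL d * LL d * (q * sg q))) ^ (1 / 2 : ℝ) := by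
  rw [mdiff_coeff, lpN]
  gcongr
  rw [ENNReal.ofReal_one, one_pow, one_mul, ta_tsum]
  apply ENNReal.ofReal_le_ofReal
  have h := (SPos.prod_sub (σ := sg) Finset.univ (fun i => SS (stdE d i) ^ α i)
    (fun i => LL d ^ α i) (fun i _ => (SPos.pow_sub (SS_pos _) (LL_sub i) _).1)
    (fun i _ => (SPos.pow_sub (SS_pos _) (LL_sub i) _).2)).2
  rw [Finset.prod_pow_eq_pow_sum, hα, sq] at h
  have h2 := (h.mul (SPos.sq q)).pos ta ta_nonneg
  rw [sub_mul, map_sub] at h2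
  have e : (∏ i, DD (stdE d i) ^ α i) * q * sg ((∏ i, DD (stdE d i) ^ α i) * q)
     = (∏ i, SS (stdE d i) ^ α i) * (q * sg q) := by
    simp only [map_mul, map_prod, map_pow, SS, mul_pow, Finset.prod_mul_distrib]
    ring
  rw [e]; linarith

theorem semiN_bound (q : RA d) :
    semiN 2 1 2 (fun x => q.coeff x) ^ 2 ≤
      ENNReal.ofReal ((3 ^ d) ^ 2 * ta (LL d * LL d * (q * sg q))) := by
  have h : semiN 2 1 2 (fun x => q.coeff x) ≤
      (3 ^ d : ℕ) * ENNReal.ofReal (ta (LL d * LL d * (q * sg q))) ^ (1 / 2 : ℝ) := by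
    rw [semiN]
    refine (Finset.sum_le_card_nsmul _ _
      (ENNReal.ofReal (ta (LL d * LL d * (q * sg q))) ^ (1 / 2 : ℝ)) ?_).trans ?_
    · intro α hα
      exact mdiff_bound _ (by simpa using hα) q
    · rw [nsmul_eq_mul]
      gcongr
      exact_mod_cast (Finset.card_le_univ _).trans (by simp)
  refine (pow_le_pow_left' h 2).trans ?_
  rw [mul_pow, ENNReal.ofReal_mul (by positivity), ← ENNReal.rpow_natCast, ← ENNReal.rpow_natCast,
    ← ENNReal.rpow_mul]
  norm_num

end Concrete

section Main
open AddMonoidAlgebra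
variable {d d₁ : ℕ}

def PP (l : Fin d₁ → Fin d → ℤ) (ρ : ℝ) (lam : Fin d₁ → ℤ → ℝ) (n : ℤ) : RA d :=
  ρ • ∑ k, lam k n • SS (l k)

theorem sg_PP (l : Fin d₁ → Fin d → ℤ) (ρ : ℝ) (lam : Fin d₁ → ℤ → ℝ) (n : ℤ) :
    sg (PP l ρ lam n) = PP l ρ lam n := by
  simp [PP, sg_SS]

theorem PP_mul_coeff (l : Fin d₁ → Fin d → ℤ) (ρ : ℝ) (lam : Fin d₁ → ℤ → ℝ) (n : ℤ)
    (q : RA d) (y : Fin d → ℤ) :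
    ((1 - PP l ρ lam n) * q).coeff y = q.coeff y +
      ρ * ∑ k, lam k n * (q.coeff (y + l k) - 2 * q.coeff y + q.coeff (y - l k)) := by
  have e : (1 - PP l ρ lam n) * q = q + ρ • ∑ k, (-lam k n) • (SS (l k) * q) := by
    simp only [PP, sub_mul, one_mul, smul_mul_assoc, Finset.sum_mul, neg_smul,
      Finset.sum_neg_distrib, smul_neg]
    ring
  rw [e]
  simp only [coeff_add, coeff_smul, coeff_sum, Finsupp.add_apply, Finsupp.smul_apply,
    Finsupp.finsetSum_apply, SS_mul_coeff, smul_eq_mul]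
  congr 2
  refine Finset.sum_congr rfl fun k _ => ?_
  ring

theorem PP_pos (l : Fin d₁ → Fin d → ℤ) {ρ : ℝ} (hρ : 0 < ρ) {δ₁ δ₂ : ℝ} (hδ : 0 < δ₁)
    (lam : Fin d₁ → ℤ → ℝ)
    (hlam : ∀ k t, lam k t ∈ Set.Icc δ₁ δ₂) (n : ℤ) : SPos sg (PP l ρ lam n) :=
  SPos.smul _ hρ.le (SPos.sum _ _ fun k _ => (SS_pos _).smul _ (hδ.le.trans (hlam k n).1))

theorem PP_le (l : Fin d₁ → Fin d → ℤ) {ρ : ℝ} (hρ : 0 < ρ) {δ₁ δ₂ : ℝ} (hδ : 0 < δ₁)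
    (lam : Fin d₁ → ℤ → ℝ)
    (hlam : ∀ k t, lam k t ∈ Set.Icc δ₁ δ₂) (n : ℤ) :
    SPos sg ((2 * (2 * ρ * d₁ * δ₂)) • (1 : RA d) - PP l ρ lam n) := by
  have e : (2 * (2 * ρ * d₁ * δ₂)) • (1 : RA d) - PP l ρ lam n =
      ρ • ∑ k, (lam k n • ((4 : ℝ) • (1 : RA d) - SS (l k)) + (4 * (δ₂ - lam k n)) • (1 : RA d)) := by
    have : ∀ k, lam k n • ((4 : ℝ) • (1 : RA d) - SS (l k)) + (4 * (δ₂ - lam k n)) • (1 : RA d)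
        = (4 * δ₂) • (1 : RA d) - lam k n • SS (l k) := by
      intro k; module
    simp only [this, Finset.sum_sub_distrib, PP, Finset.sum_const, Finset.card_univ,
      Fintype.card_fin]
    rw [smul_sub]
    rw [← Nat.cast_smul_eq_nsmul ℝ, smul_smul, smul_smul]
    congr 2; ring
  rw [e]
  refine SPos.smul _ hρ.le (SPos.sum _ _ fun k _ => SPos.add _ _ ?_ ?_)
  · exact (four_sub_SS _).smul _ (hδ.le.trans (hlam k n).1)
  · exact (SPos.one _).smul _ (by have := (hlam k n).2; linarith)

theorem PP_ge (hdd₁ : d ≤ d₁) (l : Fin d₁ → Fin d → ℤ)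
    (hl : ∀ (k : Fin d₁) (hk : (k : ℕ) < d), l k = stdE d ⟨k, hk⟩)
    {ρ : ℝ} (hρ : 0 < ρ) {δ₁ δ₂ : ℝ} (hδ : 0 < δ₁)
    (lam : Fin d₁ → ℤ → ℝ)
    (hlam : ∀ k t, lam k t ∈ Set.Icc δ₁ δ₂) (n : ℤ) :
    SPos sg (PP l ρ lam n - (ρ * δ₁) • LL d) := by
  have e : PP l ρ lam n - (ρ * δ₁) • LL d =
      ρ • (∑ k, (lam k n - δ₁) • SS (l k)) + (ρ * δ₁) • (∑ k, SS (l k) - LL d) := by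
    simp only [sub_smul, Finset.sum_sub_distrib, PP, ← Finset.smul_sum]
    module
  rw [e]
  refine SPos.add _ _ (SPos.smul _ hρ.le (SPos.sum _ _ fun k _ => (SS_pos _).smul _ ?_))
    (SPos.smul _ (by positivity) ?_)
  · linarith [(hlam k n).1]
  · have e2 : LL d = ∑ k ∈ Finset.univ.map (Fin.castLEEmb hdd₁), SS (l k) := by
      rw [Finset.sum_map, LL]
      refine Finset.sum_congr rfl fun i _ => ?_
      rw [hl _ (by simp)]; rfl
    rw [e2, ← Finset.sum_sdiff (Finset.subset_univ (Finset.univ.map (Fin.castLEEmb hdd₁))),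
      add_sub_cancel_right]
    exact SPos.sum _ _ fun _ _ => SS_pos _

theorem G_coeff (l : Fin d₁ → Fin d → ℤ) (ρ : ℝ) (lam : Fin d₁ → ℤ → ℝ)
    (G : ℤ → ℤ → (Fin d → ℤ) → ℝ)
    (hG0 : ∀ (m : ℤ) (y : Fin d → ℤ), G m m y = if y = 0 then 1 else 0)
    (hG : ∀ m nn : ℤ, m ≤ nn → ∀ y, G m (nn + 1) y =
          G m nn y + ρ * ∑ k, lam k nn * (G m nn (y + l k) - 2 * G m nn y + G m nn (y - l k)))
    (a : ℤ) (k m : ℕ) (hkm : k ≤ m) (y : Fin d → ℤ) :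
    G (a + k) (a + m) y = (∏ i ∈ Finset.Ico k m, (1 - PP l ρ lam (a + i))).coeff y := by
  induction m, hkm using Nat.le_induction generalizing y with
  | base =>
    rw [hG0, Finset.Ico_self, Finset.prod_empty, one_def]
    simp [Finsupp.single_apply, eq_comm]
  | succ m hm ih =>
    rw [Finset.prod_Ico_succ_top hm, mul_comm, PP_mul_coeff, Nat.cast_succ, ← add_assoc,
      hG _ _ (by omega)]
    simp only [ih]

def emZ (a : ℤ) : ℕ ↪ ℤ :=
  ⟨fun k : ℕ => a + (k : ℤ), by intro x y h; simpa using h⟩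

theorem emZ_apply (a : ℤ) (k : ℕ) : emZ a k = a + k := rfl

theorem u_coeff (l : Fin d₁ → Fin d → ℤ) (ρ : ℝ) (lam : Fin d₁ → ℤ → ℝ)
    (G : ℤ → ℤ → (Fin d → ℤ) → ℝ)
    (hG0 : ∀ (m : ℤ) (y : Fin d → ℤ), G m m y = if y = 0 then 1 else 0)
    (hG : ∀ m nn : ℤ, m ≤ nn → ∀ y, G m (nn + 1) y =
          G m nn y + ρ * ∑ k, lam k nn * (G m nn (y + l k) - 2 * G m nn y + G m nn (y - l k)))
    (a : ℤ) (f : ℤ → (Fin d → ℤ) → ℝ) (F : ℤ → RA d) (hF : ∀ j x, (F j).coeff x = f j x)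
    (ha : ∀ j, j < a → ∀ x, f j x = 0) (m : ℕ) (x : Fin d → ℤ) :
    (∑' j : ℤ, if j < a + m then ∑' y : Fin d → ℤ, G j (a + m) (x - y) * f j y else 0) =
      (∑ k ∈ Finset.range m,
        (∏ i ∈ Finset.Ico k m, (1 - PP l ρ lam (a + i))) * F (a + k)).coeff x := by
  rw [tsum_eq_sum (s := (Finset.range m).map (emZ a))]
  · rw [Finset.sum_map, coeff_sum, Finsupp.finsetSum_apply]
    refine Finset.sum_congr rfl fun k hk => ?_
    have hk' := Finset.mem_range.1 hk
    rw [if_pos (by rw [emZ_apply]; omega), emZ_apply, coeff_mul_apply_right, Finsupp.sum, tsum_eq_sum (s := (F (a + k)).coeff.support)]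
    · refine Finset.sum_congr rfl fun y _ => ?_
      rw [G_coeff l ρ lam G hG0 hG a k m hk'.le, hF, sub_eq_add_neg]
    · intro y hy
      rw [← hF, Finsupp.notMem_support_iff.1 hy, mul_zero]
  · intro j hj
    split_ifs with hjm
    · have : j < a := by
        by_contra hja
        apply hj
        rw [Finset.mem_map]
        exact ⟨(j - a).toNat, by simp; omega, by rw [emZ_apply]; omega⟩
      simp [ha j this]
    · rfl

end Main


/-- Lemma 5.2: Calderón–Zygmund estimate, `p = 2` case. -/
theorem discrete_calderon_zygmund_p_two
    (d d₁ : ℕ) (hd : 1 ≤ d) (hdd₁ : d ≤ d₁)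
    (l : Fin d₁ → Fin d → ℤ) (hl : ∀ (k : Fin d₁) (hk : (k : ℕ) < d), l k = stdE d ⟨k, hk⟩)
    (δ₁ δ₂ : ℝ) (hδ₁ : 0 < δ₁) (hδ₁₂ : δ₁ ≤ δ₂)
    (ρ : ℝ) (hρ : 0 < ρ) (hρ' : ρ < (2 * d₁ * δ₂)⁻¹) :
    ∃ N : ℝ, 0 < N ∧
      ∀ lam : Fin d₁ → ℤ → ℝ, (∀ k t, lam k t ∈ Set.Icc δ₁ δ₂) →
      ∀ G : ℤ → ℤ → (Fin d → ℤ) → ℝ,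
        (∀ (m : ℤ) (y : Fin d → ℤ), G m m y = if y = 0 then 1 else 0) →
        (∀ m nn : ℤ, m ≤ nn → ∀ y, G m (nn + 1) y =
          G m nn y + ρ * ∑ k, lam k nn * (G m nn (y + l k) - 2 * G m nn y + G m nn (y - l k))) →
      ∀ f : ℤ → (Fin d → ℤ) → ℝ,
        (Function.support fun q : ℤ × (Fin d → ℤ) => f q.1 q.2).Finite →
        ∑' nn : ℤ,
            semiN 2 1 2
              (fun x => ∑' j : ℤ, if j < nn then ∑' y : Fin d → ℤ, G j nn (x - y) * f j y else 0)
              ^ 2 ≤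
          ENNReal.ofReal N * ∑' q : ℤ × (Fin d → ℤ), ENNReal.ofReal (|f q.1 q.2| ^ 2) := by
  obtain ⟨c, hc⟩ : ∃ c : ℝ, c = 2 * (1 - 2 * ρ * d₁ * δ₂) * (ρ * δ₁) := ⟨_, rfl⟩
  have hd₁ : (0 : ℝ) < d₁ := by exact_mod_cast (lt_of_lt_of_le hd hdd₁)
  have hδ₂ : 0 < δ₂ := hδ₁.trans_le hδ₁₂
  have hθ : 2 * ρ * d₁ * δ₂ < 1 := by
    have h0 : 0 < 2 * d₁ * δ₂ := by positivity
    have := mul_lt_mul_of_pos_right hρ' h0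
    rw [inv_mul_cancel₀ h0.ne'] at this
    linarith
  have hc0 : 0 < c := by
    rw [hc]
    have : 0 < 1 - 2 * ρ * d₁ * δ₂ := by linarith
    positivity
  refine ⟨(3 ^ d) ^ 2 * (4 / c * (2 / c + c / 2 * (4 * d : ℝ) ^ 2)), by positivity, ?_⟩
  intro lam hlam G hG0 hG f hf
  have hfj : ∀ j, (Function.support (f j)).Finite := by
    intro j
    refine (hf.image Prod.snd).subset ?_
    intro x hx
    exact ⟨(j, x), hx, rfl⟩
  obtain ⟨F, hF⟩ : ∃ F : ℤ → RA d, ∀ j x, (F j).coeff x = f j x :=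
    ⟨fun j => AddMonoidAlgebra.ofCoeff (Finsupp.ofSupportFinite (f j) (hfj j)), fun _ _ => rfl⟩
  have hRHS : ∑' q : ℤ × (Fin d → ℤ), ENNReal.ofReal (|f q.1 q.2| ^ 2) =
      ∑' j : ℤ, ENNReal.ofReal (ta (F j * sg (F j))) := by
    rw [ENNReal.tsum_prod']
    refine tsum_congr fun j => ?_
    rw [← ta_tsum]
    refine tsum_congr fun x => ?_
    rw [hF, Real.rpow_two]
  rw [hRHS, ENNReal.tsum_eq_iSup_sum]
  refine iSup_le fun s => ?_
  have hJ := hf.image Prod.fst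
  obtain ⟨a, ha⟩ := (s.finite_toSet.union hJ).bddBelow
  obtain ⟨b, hb⟩ := s.finite_toSet.bddAbove
  have haf : ∀ j, j < a → ∀ x, f j x = 0 := by
    intro j hj x
    by_contra hne
    have := ha (Or.inr ⟨(j, x), hne, rfl⟩)
    simp only at this
    omega
  let em : ℕ ↪ ℤ := emZ a
  let n := (b - a + 1).toNat
  have hs : s ⊆ (Finset.range n).map em := by
    intro j hj
    have h1 := ha (Or.inl hj)
    have h2 := hb hj
    rw [Finset.mem_map]
    refine ⟨(j - a).toNat, ?_, ?_⟩
    · rw [Finset.mem_range]; omega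
    · change a + ((j - a).toNat : ℤ) = j
      omega
  refine (Finset.sum_le_sum_of_subset hs).trans ?_
  rw [Finset.sum_map]
  let U : ℕ → RA d := fun m => ∑ k ∈ Finset.range m,
        (∏ i ∈ Finset.Ico k m, (1 - PP l ρ lam (a + i))) * F (a + k)
  have hU : ∀ m : ℕ, (fun x => ∑' j : ℤ, if j < em m then
      ∑' y : Fin d → ℤ, G j (em m) (x - y) * f j y else 0) = fun x => (U m).coeff x := by
    intro m; funext x
    exact u_coeff l ρ lam G hG0 hG a f F hF haf m x
  simp only [hU]
  have hUs : ∀ m, U (m + 1) = (1 - PP l ρ lam (a + m)) * (U m + F (a + m)) := by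
    intro m
    simp only [U]
    rw [Finset.sum_range_succ, mul_add, Finset.mul_sum]
    congr 1
    · refine Finset.sum_congr rfl fun k hk => ?_
      rw [Finset.prod_Ico_succ_top (Finset.mem_range.1 hk).le]; ring
    · simp
  have main := energy_sum sg sg_sg ta ta_nonneg (LL d) (fun m => PP l ρ lam (a + m)) sg_LL
    (fun m => sg_PP _ _ _ _) (2 * ρ * d₁ * δ₂) (ρ * δ₁) (4 * d) hθ (by positivity) LL_pos
    (fun m => PP_pos l hρ hδ₁ lam hlam _) (fun m => PP_le l hρ hδ₁ lam hlam _)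
    (fun m => PP_ge hdd₁ l hl hρ hδ₁ lam hlam _) LL_le U (fun m => F (a + m)) (by simp [U]) hUs
    c hc n
  calc _ ≤ ∑ m ∈ Finset.range n,
        ENNReal.ofReal ((3 ^ d) ^ 2 * ta (LL d * LL d * (U m * sg (U m)))) :=
        Finset.sum_le_sum fun m _ => semiN_bound _
    _ = ENNReal.ofReal ((3 ^ d) ^ 2 * ∑ m ∈ Finset.range n, ta (LL d * LL d * (U m * sg (U m)))) := by
        rw [Finset.mul_sum, ENNReal.ofReal_sum_of_nonneg]
        intro m _
        have := ((LL_pos.mul LL_pos).mul (SPos.sq (U m))).pos ta ta_nonneg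
        positivity
    _ ≤ ENNReal.ofReal ((3 ^ d) ^ 2 * (4 / c * (2 / c + c / 2 * (4 * d : ℝ) ^ 2)) *
          ∑ m ∈ Finset.range n, ta (F (a + m) * sg (F (a + m)))) := by
        apply ENNReal.ofReal_le_ofReal
        rw [mul_assoc]
        exact mul_le_mul_of_nonneg_left main (by positivity)
    _ ≤ _ := by
        rw [ENNReal.ofReal_mul (by positivity), ENNReal.ofReal_sum_of_nonneg
          (fun _ _ => ta_nonneg _)]
        gcongr
        have := ENNReal.sum_le_tsum (f := fun j : ℤ => ENNReal.ofReal (ta (F j * sg (F j))))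
          ((Finset.range n).map em)
        rw [Finset.sum_map] at this
        exact this
end
end

section
/- In the setting of the discrete heat kernel G, there is a constant N, depending only on d, d₁, δ₁*, δ₂*, ρ and the vectors l₁,…,l_{d₁}, with the following property. Let r∈ℕ, let (n,x)∈Q_r(0,0) (i.e. |n|<r² and ‖x‖<r), let j∈ℤ with j≤n−1, let g : ℤ×ℤ^d→ℝ be finitely supported with g(t,y)=0 for all t whenever ‖y‖<2r, and let α∈ℤ₊^d be a multi-index with |α|=1 or |α|=2. Then | Σ_{y∈ℤ^d} δ^α G(j,n,y) g(j,x−y) | ≤ N r^{−|α|} ℳ_x g(j,0). -/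
open scoped ENNReal BigOperators

noncomputable section

/-- `‖x‖ = max_i |x^i|` on `ℤ^d`, as a natural number. -/
def supNat {d : ℕ} (x : Fin d → ℤ) : ℕ := Finset.univ.sup fun i => (x i).natAbs

/-- the box `C_r(x) = Π_i ((x^i - r, x^i + r) ∩ ℤ)`. -/
def Cbox {d : ℕ} (r : ℕ) (x : Fin d → ℤ) : Finset (Fin d → ℤ) :=
  Finset.Icc (fun i => x i - r + 1) (fun i => x i + r - 1)

/-- the spatial maximal function `ℳ_x g (t, x) = sup_{r ∈ ℕ} |C_r(x)|⁻¹ Σ_{y ∈ C_r(x)} |g(t,y)|`. -/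
noncomputable def maxX {d : ℕ} (g : ℤ → (Fin d → ℤ) → ℝ) (t : ℤ) (x : Fin d → ℤ) : ℝ :=
  ⨆ r : ℕ+, (((2 * (r : ℕ) - 1 : ℕ) : ℝ) ^ d)⁻¹ * ∑ y ∈ Cbox (r : ℕ) x, |g t y|


/-! ### Elementary estimates -/

lemma aux_normSq_cosh (q w V U : ℝ) :
    ‖(q : ℂ) + w * Complex.cosh (V + U * Complex.I)‖ ^ 2 =
      (q + w * (Real.cosh V * Real.cos U)) ^ 2 + (w * (Real.sinh V * Real.sin U)) ^ 2 := by
  rw [Complex.cosh_add, Complex.cosh_mul_I, Complex.sinh_mul_I]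
  rw [← Complex.normSq_eq_norm_sq, Complex.normSq_apply]
  rw [← Complex.ofReal_cosh, ← Complex.ofReal_sinh, ← Complex.ofReal_cos, ← Complex.ofReal_sin]
  simp
  have h1 : (Complex.cos U).re = Real.cos U := rfl
  have h2 : (Complex.sinh V).re = Real.sinh V := rfl
  have h3 : (Complex.sin U).re = Real.sin U := rfl
  rw [h1, h2, h3]
  ring

lemma aux_norm_cosh (q w V U : ℝ) (hq : 0 ≤ q) (hw : 0 ≤ w) (hqw : q + w ≤ 1) :
    ‖(q : ℂ) + w * Complex.cosh (V + U * Complex.I)‖ ≤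
      q + w * Real.cosh V - q * w * (1 - Real.cos U) := by
  have hc : 1 ≤ Real.cosh V := Real.one_le_cosh V
  have h1 : Real.cos U ≤ 1 := Real.cos_le_one U
  have h2 : -1 ≤ Real.cos U := Real.neg_one_le_cos U
  have hsc : Real.cosh V ^ 2 = Real.sinh V ^ 2 + 1 := Real.cosh_sq V
  have hs : Real.sin U ^ 2 = 1 - Real.cos U ^ 2 := Real.sin_sq U
  set c := Real.cosh V
  set s := Real.sinh V
  set a := Real.cos U
  set b := Real.sin U
  have hqw0 : 0 ≤ q * w := mul_nonneg hq hw
  have hS : q + w * c ≤ c := by nlinarith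
  have hpos : 0 ≤ q + w * c - q * w * (1 - a) := by
    have : q * w * (1 - a) ≤ q * w * 2 := mul_le_mul_of_nonneg_left (by linarith) hqw0
    have h3 : w ≤ w * c := by nlinarith
    nlinarith
  refine le_of_sq_le_sq ?_ hpos
  rw [aux_normSq_cosh]
  change (q + w * (c * a)) ^ 2 + (w * (s * b)) ^ 2 ≤ _
  have e1 : (q + w * (c * a)) ^ 2 + (w * (s * b)) ^ 2 =
      q ^ 2 + 2 * (q * w) * (c * a) + w ^ 2 * (c ^ 2 * a ^ 2 + s ^ 2 * b ^ 2) := by ring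
  have e2 : c ^ 2 * a ^ 2 + s ^ 2 * b ^ 2 ≤ c ^ 2 := by
    rw [hs, hsc]; nlinarith [sq_nonneg b]
  have e3 : w ^ 2 * (c ^ 2 * a ^ 2 + s ^ 2 * b ^ 2) ≤ w ^ 2 * c ^ 2 :=
    mul_le_mul_of_nonneg_left e2 (sq_nonneg w)
  have e4 : (q + w * c) * (q * w * (1 - a)) ≤ c * (q * w * (1 - a)) :=
    mul_le_mul_of_nonneg_right hS (mul_nonneg hqw0 (by linarith))
  nlinarith [sq_nonneg (q * w * (1 - a))]

lemma aux_symbol {ι : Type*} [Fintype ι] (q : ℝ) (w V U : ι → ℝ) (hq : 0 ≤ q) (hw : ∀ k, 0 ≤ w k)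
    (hsum : ∑ k, (q + w k) ≤ 1) :
    ‖(1 : ℂ) + ∑ k, (w k : ℂ) * (Complex.cosh (V k + U k * Complex.I) - 1)‖ ≤
      Real.exp (∑ k, w k * (Real.cosh (V k) - 1) - q * ∑ k, w k * (1 - Real.cos (U k))) := by
  have e : (1 : ℂ) + ∑ k, (w k : ℂ) * (Complex.cosh (V k + U k * Complex.I) - 1) =
      ((1 - ∑ k, (q + w k) : ℝ) : ℂ) +
        ∑ k, ((q : ℂ) + w k * Complex.cosh (V k + U k * Complex.I)) := by
    push_cast
    simp only [mul_sub, Finset.sum_sub_distrib, Finset.sum_add_distrib, mul_one]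
    ring
  rw [e]
  refine (norm_add_le _ _).trans ?_
  rw [Complex.norm_real, Real.norm_of_nonneg (by linarith)]
  have h1 : ‖∑ k, ((q : ℂ) + w k * Complex.cosh (V k + U k * Complex.I))‖ ≤
      ∑ k, (q + w k * Real.cosh (V k) - q * w k * (1 - Real.cos (U k))) := by
    refine norm_sum_le_of_le _ fun k _ => aux_norm_cosh _ _ _ _ hq (hw k) ?_
    refine le_trans ?_ hsum
    exact Finset.single_le_sum (f := fun k => q + w k) (fun i _ => add_nonneg hq (hw i))
      (Finset.mem_univ k)
  have h2 := Real.add_one_le_exp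
    (∑ k, w k * (Real.cosh (V k) - 1) - q * ∑ k, w k * (1 - Real.cos (U k)))
  refine le_trans (add_le_add_right h1 _) (le_trans (le_of_eq ?_) h2)
  simp only [Finset.sum_sub_distrib, Finset.sum_add_distrib, mul_sub, Finset.mul_sum, mul_one,
    mul_assoc]
  ring

lemma aux_exp_sub_one (a b : ℝ) (ha : |a| ≤ 1) :
    ‖Complex.exp (-((a : ℂ) + b * Complex.I)) - 1‖ ≤ 3 * (|b| + |a|) := by
  have e : Complex.exp (-((a : ℂ) + b * Complex.I)) - 1 =
      ((Real.exp (-a) : ℝ) : ℂ) * (Complex.exp (Complex.I * ((-b : ℝ) : ℂ)) - 1) +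
        ((Real.exp (-a) - 1 : ℝ) : ℂ) := by
    push_cast
    rw [mul_sub, ← Complex.exp_add]
    ring_nf
  rw [e]
  refine (norm_add_le _ _).trans ?_
  rw [norm_mul, Complex.norm_real, Complex.norm_real]
  have h1 : ‖Complex.exp (Complex.I * ((-b : ℝ) : ℂ)) - 1‖ ≤ |b| := by
    refine Real.norm_exp_I_mul_ofReal_sub_one_le.trans ?_
    simp
  have h2 : ‖Real.exp (-a)‖ ≤ 3 := by
    rw [Real.norm_of_nonneg (Real.exp_pos _).le]
    have : Real.exp (-a) ≤ Real.exp 1 := Real.exp_le_exp.2 (by linarith [(abs_le.1 ha).1])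
    linarith [Real.exp_one_lt_d9]
  have h3 : ‖Real.exp (-a) - 1‖ ≤ 2 * |a| := by
    have := Real.abs_exp_sub_one_le (x := -a) (by simpa using ha)
    simpa using this
  have := mul_le_mul h2 h1 (norm_nonneg _) (by norm_num)
  linarith [abs_nonneg a, abs_nonneg b]

/-- one-dimensional weight bound -/
lemma aux_poly_gauss (c h t : ℝ) (hc : 0 < c) (hh : 0 < h) (a : ℕ) (ha : a ≤ 2) :
    (3 * (|t| + h)) ^ a * Real.exp (-(2 * c) * (t / h) ^ 2) ≤
      3 ^ a * h ^ a * ((2 + 2 / c) * Real.exp (-(c / h ^ 2) * t ^ 2)) := by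
  have e0 : |t| + h = h * (|t / h| + 1) := by
    rw [abs_div, abs_of_pos hh]; field_simp
  set u := t / h with hu
  have e1 : (c / h ^ 2) * t ^ 2 = c * u ^ 2 := by rw [hu]; field_simp
  have h1 : (|u| + 1) ^ a ≤ (|u| + 1) ^ 2 := pow_le_pow_right₀ (by linarith [abs_nonneg u]) ha
  have h2 : (|u| + 1) ^ 2 ≤ 2 + 2 * u ^ 2 := by
    nlinarith [sq_nonneg (|u| - 1), sq_abs u]
  have h3 := Real.add_one_le_exp (c * u ^ 2)
  have h4 : (2 + 2 * u ^ 2) ≤ (2 + 2 / c) * Real.exp (c * u ^ 2) := by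
    have h5 : u ^ 2 = (1 / c) * (c * u ^ 2) := by field_simp
    have h6 : 0 ≤ 1 / c := by positivity
    have h7 : u ^ 2 ≤ (1 / c) * Real.exp (c * u ^ 2) := by
      rw [h5]; refine mul_le_mul_of_nonneg_left ?_ h6; rw [← h5]; linarith
    have h8 : 1 ≤ Real.exp (c * u ^ 2) := Real.one_le_exp (by positivity)
    have : (2 + 2 / c) * Real.exp (c * u ^ 2) =
      2 * Real.exp (c * u ^ 2) + 2 * ((1 / c) * Real.exp (c * u ^ 2)) := by ring
    linarith
  have e2 : Real.exp (-(2 * c) * u ^ 2) = Real.exp (-(c * u ^ 2)) * Real.exp (-(c * u ^ 2)) := by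
    rw [← Real.exp_add]; ring_nf
  rw [e0, mul_pow, mul_pow, e2, neg_mul, e1]
  have h9 : (|u| + 1) ^ a * Real.exp (-(c * u ^ 2)) ≤ 2 + 2 / c := by
    rw [Real.exp_neg, ← div_eq_mul_inv, div_le_iff₀ (Real.exp_pos _)]
    linarith
  calc 3 ^ a * (h ^ a * (|u| + 1) ^ a) * (Real.exp (-(c * u ^ 2)) * Real.exp (-(c * u ^ 2)))
      = 3 ^ a * h ^ a * (((|u| + 1) ^ a * Real.exp (-(c * u ^ 2))) * Real.exp (-(c * u ^ 2))) := by
        ring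
    _ ≤ _ := by gcongr

lemma aux_decay (h Y : ℝ) (hh : 0 < h) (hY : 0 < Y) (p : ℕ) :
    h ^ p * Real.exp (-(h * Y)) ≤ (p.factorial : ℝ) * (Y ^ p)⁻¹ := by
  have h1 := Real.pow_div_factorial_le_exp (h * Y) (by positivity) p
  have hf : (0 : ℝ) < p.factorial := by exact_mod_cast p.factorial_pos
  rw [div_le_iff₀ hf, mul_pow] at h1
  rw [Real.exp_neg, ← div_eq_mul_inv, ← div_eq_mul_inv, div_le_div_iff₀ (Real.exp_pos _) (by positivity)]
  linarith

/-! ### Fourier representation -/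

def muT (d : ℕ) : MeasureTheory.Measure (Fin d → ℝ) :=
  MeasureTheory.Measure.pi fun _ : Fin d =>
    (MeasureTheory.volume : MeasureTheory.Measure ℝ).restrict (Set.Icc (-Real.pi) Real.pi)

def zd {d : ℕ} (v θ : Fin d → ℝ) (y : Fin d → ℤ) : ℂ :=
  ∑ i, ((v i : ℂ) + θ i * Complex.I) * (y i : ℂ)

lemma zd_add {d : ℕ} (v θ : Fin d → ℝ) (y z : Fin d → ℤ) :
    zd v θ (y + z) = zd v θ y + zd v θ z := by
  simp [zd, mul_add, Finset.sum_add_distrib]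

lemma zd_sub {d : ℕ} (v θ : Fin d → ℝ) (y z : Fin d → ℤ) :
    zd v θ (y - z) = zd v θ y - zd v θ z := by
  simp [zd, mul_sub, Finset.sum_sub_distrib]

lemma zd_stdE {d : ℕ} (v θ : Fin d → ℝ) (i : Fin d) :
    zd v θ (stdE d i) = (v i : ℂ) + θ i * Complex.I := by
  simp [zd, stdE]

lemma zd_eq {d : ℕ} (v θ : Fin d → ℝ) (y : Fin d → ℤ) :
    zd v θ y = ((∑ i, v i * y i : ℝ) : ℂ) + ((∑ i, θ i * y i : ℝ) : ℂ) * Complex.I := by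
  simp only [zd, add_mul, Finset.sum_add_distrib]
  push_cast
  rw [Finset.sum_mul]
  congr 1
  exact Finset.sum_congr rfl fun i _ => by ring

lemma zd_cont {d : ℕ} (v : Fin d → ℝ) (y : Fin d → ℤ) : Continuous fun θ => zd v θ y := by
  unfold zd; fun_prop

lemma norm_exp_zd {d : ℕ} (v θ : Fin d → ℝ) (y : Fin d → ℤ) :
    ‖Complex.exp (-zd v θ y)‖ = Real.exp (-∑ i, v i * y i) := by
  rw [Complex.norm_exp, zd_eq]
  congr 1
  rw [Complex.neg_re, Complex.add_re, Complex.ofReal_re, Complex.re_ofReal_mul, Complex.I_re]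
  simp

lemma integrable_muT {d : ℕ} {E : Type*} [NormedAddCommGroup E] {f : (Fin d → ℝ) → E}
    (hf : Continuous f) :
    MeasureTheory.Integrable f (muT d) := by
  unfold muT
  rw [← MeasureTheory.Measure.restrict_pi_pi]
  exact hf.continuousOn.integrableOn_compact (isCompact_univ_pi fun _ => isCompact_Icc)

lemma ae_muT (d : ℕ) : ∀ᵐ θ ∂(muT d), ∀ i, |θ i| ≤ Real.pi := by
  unfold muT
  rw [← MeasureTheory.Measure.restrict_pi_pi]
  rw [MeasureTheory.ae_restrict_iff' (MeasurableSet.univ_pi fun _ => measurableSet_Icc)]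
  refine Filter.Eventually.of_forall fun θ hθ i => ?_
  exact abs_le.2 (hθ i (Set.mem_univ i))

def II {d : ℕ} (v : Fin d → ℝ) (φ : (Fin d → ℝ) → ℂ) (y : Fin d → ℤ) : ℂ :=
  (((2 * Real.pi) ^ d : ℝ) : ℂ)⁻¹ * ∫ θ, φ θ * Complex.exp (-zd v θ y) ∂(muT d)

lemma II_integrable {d : ℕ} (v : Fin d → ℝ) {φ : (Fin d → ℝ) → ℂ} (hφ : Continuous φ)
    (y : Fin d → ℤ) :
    MeasureTheory.Integrable (fun θ => φ θ * Complex.exp (-zd v θ y)) (muT d) := by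
  apply integrable_muT
  have := zd_cont v y
  fun_prop

lemma II_fdiff {d : ℕ} (v : Fin d → ℝ) {φ : (Fin d → ℝ) → ℂ} (hφ : Continuous φ)
    (f : (Fin d → ℤ) → ℝ) (hf : ∀ y, (f y : ℂ) = II v φ y) (ξ : Fin d → ℤ) (y : Fin d → ℤ) :
    ((fdiff 1 ξ f y : ℝ) : ℂ) = II v (fun θ => φ θ * (Complex.exp (-zd v θ ξ) - 1)) y := by
  unfold fdiff
  push_cast
  rw [hf, hf, div_one]
  unfold II
  rw [← mul_sub, ← MeasureTheory.integral_sub (II_integrable v hφ _) (II_integrable v hφ _)]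
  congr 2
  funext θ
  rw [zd_add, neg_add, Complex.exp_add]
  ring

lemma II_iter {d : ℕ} (v : Fin d → ℝ) (ξ : Fin d → ℤ) (a : ℕ) {φ : (Fin d → ℝ) → ℂ}
    (hφ : Continuous φ)
    (f : (Fin d → ℤ) → ℝ) (hf : ∀ y, (f y : ℂ) = II v φ y) (y : Fin d → ℤ) :
    (((fdiff 1 ξ)^[a] f y : ℝ) : ℂ) =
      II v (fun θ => φ θ * (Complex.exp (-zd v θ ξ) - 1) ^ a) y := by
  induction a generalizing y with
  | zero => simpa using hf y
  | succ a ih =>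
    rw [Function.iterate_succ_apply']
    have := zd_cont v ξ
    rw [II_fdiff v (φ := fun θ => φ θ * (Complex.exp (-zd v θ ξ) - 1) ^ a) (by fun_prop) _ ih]
    congr 1
    funext θ
    ring

lemma II_mdiff {d : ℕ} (v : Fin d → ℝ) (α : Fin d → ℕ) {φ : (Fin d → ℝ) → ℂ}
    (hφ : Continuous φ)
    (f : (Fin d → ℤ) → ℝ) (hf : ∀ y, (f y : ℂ) = II v φ y) (y : Fin d → ℤ) :
    ((mdiff 1 α f y : ℝ) : ℂ) =
      II v (fun θ => φ θ * ∏ i, (Complex.exp (-((v i : ℂ) + θ i * Complex.I)) - 1) ^ α i) y := by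
  have key : ∀ L : List (Fin d), ∀ y,
      ((L.foldr (fun i g => (fdiff 1 (stdE d i))^[α i] g) f y : ℝ) : ℂ) =
      II v (fun θ => φ θ * (L.map fun i =>
        (Complex.exp (-((v i : ℂ) + θ i * Complex.I)) - 1) ^ α i).prod) y := by
    intro L
    induction L with
    | nil => intro y; simpa using hf y
    | cons i L ih =>
      intro y
      rw [List.foldr_cons]
      rw [II_iter v _ _ (φ := fun θ => φ θ * (L.map fun i =>
        (Complex.exp (-((v i : ℂ) + θ i * Complex.I)) - 1) ^ α i).prod) ?_ _ ih]
      · congr 1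
        funext θ
        rw [zd_stdE, List.map_cons, List.prod_cons]
        ring
      · refine hφ.mul ?_
        refine continuous_list_prod _ fun i _ => ?_
        fun_prop
  have := key (List.finRange d) y
  unfold mdiff
  rw [this]
  congr 1

lemma aux_int1 (m : ℤ) : ∫ t in Set.Icc (-Real.pi) Real.pi, Complex.exp (-(t * Complex.I * m)) =
    if m = 0 then ((2 * Real.pi : ℝ) : ℂ) else 0 := by
  rw [MeasureTheory.integral_Icc_eq_integral_Ioc,
    ← intervalIntegral.integral_of_le (by linarith [Real.pi_pos])]
  split_ifs with h
  · subst h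
    simp
    ring
  · have hc : (-(Complex.I * m) : ℂ) ≠ 0 := by
      simp [Complex.I_ne_zero, h]
    have e : ∀ t : ℝ, -((t : ℂ) * Complex.I * m) = (-(Complex.I * m)) * t := fun t => by ring
    simp_rw [e]
    rw [integral_exp_mul_complex hc]
    rw [div_eq_zero_iff]
    left
    have : (-(Complex.I * m) * ((-Real.pi : ℝ) : ℂ)) =
      (-(Complex.I * m) * (Real.pi : ℂ)) + m * (2 * Real.pi * Complex.I) := by
      push_cast; ring
    rw [this, Complex.exp_add, Complex.exp_int_mul_two_pi_mul_I]
    ring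

lemma II_one {d : ℕ} (v : Fin d → ℝ) (y : Fin d → ℤ) :
    II v (fun _ => 1) y = if y = 0 then 1 else 0 := by
  unfold II
  have e : ∀ θ : Fin d → ℝ, (1 : ℂ) * Complex.exp (-zd v θ y) =
      Complex.exp (-((∑ i, v i * y i : ℝ) : ℂ)) *
        ∏ i, Complex.exp (-(θ i * Complex.I * y i)) := by
    intro θ
    rw [← Complex.exp_sum, ← Complex.exp_add, one_mul]
    congr 1
    unfold zd
    push_cast
    simp only [add_mul, Finset.sum_add_distrib, Finset.sum_neg_distrib]
    ring
  simp_rw [e]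
  rw [MeasureTheory.integral_const_mul]
  unfold muT
  rw [MeasureTheory.integral_fintype_prod_eq_prod
    (f := fun i (t : ℝ) => Complex.exp (-(t * Complex.I * y i)))]
  simp_rw [aux_int1]
  split_ifs with h
  · subst h
    have : (Real.pi : ℂ) ≠ 0 := by exact_mod_cast Real.pi_pos.ne'
    simp [mul_pow]
    field_simp
  · obtain ⟨i, hi⟩ := Function.ne_iff.1 h
    rw [Finset.prod_eq_zero (Finset.mem_univ i)]
    · simp
    · simpa using hi

def aS {d d₁ : ℕ} (ρ : ℝ) (l : Fin d₁ → Fin d → ℤ) (c : Fin d₁ → ℝ) (v θ : Fin d → ℝ) : ℂ :=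
  1 + ∑ k, ((2 * ρ * c k : ℝ) : ℂ) * (Complex.cosh (zd v θ (l k)) - 1)

lemma aS_cont {d d₁ : ℕ} (ρ : ℝ) (l : Fin d₁ → Fin d → ℤ) (c : Fin d₁ → ℝ) (v : Fin d → ℝ) :
    Continuous (aS ρ l c v) := by
  unfold aS
  have := fun k => zd_cont v (l k)
  fun_prop

lemma II_rep {d d₁ : ℕ} (ρ : ℝ) (l : Fin d₁ → Fin d → ℤ) (lam : Fin d₁ → ℤ → ℝ)
    (G : ℤ → ℤ → (Fin d → ℤ) → ℝ)
    (h0 : ∀ (m : ℤ) (y : Fin d → ℤ), G m m y = if y = 0 then 1 else 0)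
    (h1 : ∀ m nn : ℤ, m ≤ nn → ∀ y, G m (nn + 1) y =
          G m nn y + ρ * ∑ k, lam k nn * (G m nn (y + l k) - 2 * G m nn y + G m nn (y - l k)))
    (v : Fin d → ℝ) (j : ℤ) (T : ℕ) (y : Fin d → ℤ) :
    (G j (j + T) y : ℂ) =
      II v (fun θ => ∏ t ∈ Finset.range T, aS ρ l (fun k => lam k (j + t)) v θ) y := by
  induction T generalizing y with
  | zero =>
    simp only [Nat.cast_zero, add_zero, Finset.range_zero, Finset.prod_empty]
    rw [II_one, h0]
    split_ifs <;> simp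
  | succ T ih =>
    have e : j + ((T + 1 : ℕ) : ℤ) = (j + T) + 1 := by push_cast; ring
    rw [e, h1 _ _ (by omega)]
    push_cast
    simp only [ih]
    set φ : (Fin d → ℝ) → ℂ := fun θ =>
      ∏ t ∈ Finset.range T, aS ρ l (fun k => lam k (j + t)) v θ with hφd
    have hφ : Continuous φ := by
      refine continuous_finsetProd _ fun t _ => aS_cont _ _ _ _
    have hi := II_integrable v hφ
    unfold II
    set K : ℂ := (((2 * Real.pi) ^ d : ℝ) : ℂ)⁻¹
    have e2 : ∀ k, (lam k (j + T) : ℂ) * (K * ∫ θ, φ θ * Complex.exp (-zd v θ (y + l k)) ∂(muT d)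
        - 2 * (K * ∫ θ, φ θ * Complex.exp (-zd v θ y) ∂(muT d)) +
        K * ∫ θ, φ θ * Complex.exp (-zd v θ (y - l k)) ∂(muT d)) =
        K * ∫ θ, (lam k (j + T) : ℂ) * (φ θ * Complex.exp (-zd v θ (y + l k)) -
          2 * (φ θ * Complex.exp (-zd v θ y)) + φ θ * Complex.exp (-zd v θ (y - l k))) ∂(muT d) := by
      intro k
      have ha := MeasureTheory.integral_add ((hi (y + l k)).sub ((hi y).const_mul 2)) (hi (y - l k))
      simp only [Pi.sub_apply] at ha
      rw [MeasureTheory.integral_const_mul, ha,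
        MeasureTheory.integral_sub (hi _) ((hi _).const_mul _),
        MeasureTheory.integral_const_mul]
      ring
    simp only [e2]
    rw [← Finset.mul_sum, ← MeasureTheory.integral_finsetSum]
    · rw [mul_left_comm, ← MeasureTheory.integral_const_mul (ρ : ℂ), ← mul_add,
        ← MeasureTheory.integral_add]
      · congr 2
        funext θ
        rw [Finset.prod_range_succ]
        change _ = φ θ * _ * _
        have e3 : ∀ k, (lam k (j + T) : ℂ) * (φ θ * Complex.exp (-zd v θ (y + l k)) -
          2 * (φ θ * Complex.exp (-zd v θ y)) + φ θ * Complex.exp (-zd v θ (y - l k))) =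
          (φ θ * Complex.exp (-zd v θ y)) *
            (2 * lam k (j + T) * (Complex.cosh (zd v θ (l k)) - 1)) := by
          intro k
          rw [zd_add, zd_sub, Complex.cosh, neg_add, neg_sub, sub_eq_add_neg (zd v θ (l k)),
            Complex.exp_add, Complex.exp_add]
          ring
        simp only [e3]
        rw [← Finset.mul_sum]
        unfold aS
        have e4 : ∑ k, ((2 * ρ * lam k (j + T) : ℝ) : ℂ) * (Complex.cosh (zd v θ (l k)) - 1) =
          ρ * ∑ k, (2 * lam k (j + T) * (Complex.cosh (zd v θ (l k)) - 1)) := by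
          rw [Finset.mul_sum]
          refine Finset.sum_congr rfl fun k _ => ?_
          push_cast
          ring
        rw [e4]
        ring
      · exact hi _
      · refine MeasureTheory.Integrable.const_mul ?_ _
        refine MeasureTheory.integrable_finsetSum _ fun k _ => ?_
        exact (((hi _).sub ((hi _).const_mul _)).add (hi _)).const_mul _
    · intro k _
      exact (((hi _).sub ((hi _).const_mul _)).add (hi _)).const_mul _

/-! ### Pointwise kernel bound -/

lemma aS_bound {d d₁ : ℕ} (hdd₁ : d ≤ d₁) (l : Fin d₁ → Fin d → ℤ)
    (hl : ∀ (k : Fin d₁) (hk : (k : ℕ) < d), l k = stdE d ⟨k, hk⟩)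
    (δ₁ ρ q C h : ℝ) (hδ₁ : 0 < δ₁) (hρ : 0 < ρ) (hq : 0 ≤ q) (hC : 0 ≤ C)
    (cc : Fin d₁ → ℝ) (hcc : ∀ k, δ₁ ≤ cc k) (hsum : ∑ k, (q + 2 * ρ * cc k) ≤ 1)
    (v : Fin d → ℝ) (hv : ∀ k, Real.cosh (∑ i, v i * l k i) - 1 ≤ h ^ 2 * C)
    (θ : Fin d → ℝ) (hθ : ∀ i, |θ i| ≤ Real.pi) :
    ‖aS ρ l cc v θ‖ ≤ Real.exp (h ^ 2 * C -
      (2 * (2 * q * ρ * δ₁ / Real.pi ^ 2)) * ∑ i, θ i ^ 2) := by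
  unfold aS
  simp only [zd_eq]
  have hw : ∀ k, 0 ≤ 2 * ρ * cc k := fun k =>
    mul_nonneg (by positivity) (hδ₁.le.trans (hcc k))
  refine (aux_symbol q (fun k => 2 * ρ * cc k) (fun k => ∑ i, v i * l k i)
    (fun k => ∑ i, θ i * l k i) hq hw hsum).trans ?_
  apply Real.exp_le_exp.2
  have h1 : ∑ k, 2 * ρ * cc k * (Real.cosh (∑ i, v i * l k i) - 1) ≤ h ^ 2 * C := by
    calc ∑ k, 2 * ρ * cc k * (Real.cosh (∑ i, v i * l k i) - 1)
        ≤ ∑ k, 2 * ρ * cc k * (h ^ 2 * C) :=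
          Finset.sum_le_sum fun k _ => mul_le_mul_of_nonneg_left (hv k) (hw k)
      _ = (∑ k, 2 * ρ * cc k) * (h ^ 2 * C) := by rw [Finset.sum_mul]
      _ ≤ 1 * (h ^ 2 * C) := by
          refine mul_le_mul_of_nonneg_right ?_ (by positivity)
          refine le_trans (Finset.sum_le_sum fun k _ => ?_) hsum
          linarith
      _ = _ := one_mul _
  have h2 : ∑ i, 2 * ρ * δ₁ * (2 / Real.pi ^ 2 * θ i ^ 2) ≤
      ∑ k, 2 * ρ * cc k * (1 - Real.cos (∑ i, θ i * l k i)) := by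
    have hn : ∀ k, 0 ≤ 2 * ρ * cc k * (1 - Real.cos (∑ i, θ i * l k i)) := fun k =>
      mul_nonneg (hw k) (by linarith [Real.cos_le_one (∑ i, θ i * l k i)])
    refine le_trans ?_ (Finset.sum_le_sum_of_subset_of_nonneg
      (Finset.subset_univ ((Finset.univ : Finset (Fin d)).map (Fin.castLEEmb hdd₁)))
      fun k _ _ => hn k)
    rw [Finset.sum_map]
    refine Finset.sum_le_sum fun m _ => ?_
    have e : l (Fin.castLEEmb hdd₁ m) = stdE d m :=
      hl (Fin.castLEEmb hdd₁ m) m.isLt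
    have e2 : ∑ i, θ i * ((l (Fin.castLEEmb hdd₁ m) i : ℤ) : ℝ) = θ m := by
      rw [e]; simp [stdE]
    rw [e2]
    have h3 := Real.cos_le_one_sub_mul_cos_sq (hθ m)
    have h4 : 2 * ρ * δ₁ ≤ 2 * ρ * cc (Fin.castLEEmb hdd₁ m) :=
      mul_le_mul_of_nonneg_left (hcc _) (by positivity)
    refine mul_le_mul h4 (by linarith) (by positivity) (hw _)
  have h3 := mul_le_mul_of_nonneg_left h2 hq
  have h4 : q * ∑ i, 2 * ρ * δ₁ * (2 / Real.pi ^ 2 * θ i ^ 2) =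
      (2 * (2 * q * ρ * δ₁ / Real.pi ^ 2)) * ∑ i, θ i ^ 2 := by
    rw [Finset.mul_sum, Finset.mul_sum]
    refine Finset.sum_congr rfl fun i _ => by ring
  rw [h4] at h3
  linarith

lemma aux_cosh (V h L : ℝ) (hh : h ^ 2 ≤ 1) (hL : 0 ≤ L) (hV : V ^ 2 ≤ h ^ 2 * L) :
    Real.cosh V - 1 ≤ h ^ 2 * (L / 2 * Real.exp (L / 2)) := by
  have h1 := Real.cosh_le_exp_half_sq V
  have h2 : V ^ 2 / 2 ≤ h ^ 2 * (L / 2) := by linarith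
  have h2' : h ^ 2 * (L / 2) ≤ L / 2 := by nlinarith
  set x := h ^ 2 * (L / 2) with hx
  have hx0 : 0 ≤ x := by positivity
  have h3 : Real.exp (V ^ 2 / 2) ≤ Real.exp x := Real.exp_le_exp.2 h2
  have h4 := Real.add_one_le_exp (-x)
  have h5 : Real.exp (-x) * Real.exp x = 1 := by rw [← Real.exp_add]; simp
  have h6 : Real.exp x - 1 ≤ x * Real.exp x := by
    nlinarith [Real.exp_pos x]
  have h7 : x * Real.exp x ≤ x * Real.exp (L / 2) :=
    mul_le_mul_of_nonneg_left (Real.exp_le_exp.2 h2') hx0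
  have h8 : h ^ 2 * (L / 2 * Real.exp (L / 2)) = x * Real.exp (L / 2) := by rw [hx]; ring
  linarith

lemma II_bound {d : ℕ} (c C h Y : ℝ) (hc : 0 < c) (hh : 0 < h) (hh1 : h ≤ 1)
    (v : Fin d → ℝ) (hv : ∀ i, |v i| ≤ h) (α : Fin d → ℕ) (hα : ∀ i, α i ≤ 2)
    (φ : (Fin d → ℝ) → ℂ)
    (hb : ∀ θ : Fin d → ℝ, (∀ i, |θ i| ≤ Real.pi) →
      ‖φ θ‖ ≤ Real.exp (C - (2 * c) * ∑ i, (θ i / h) ^ 2))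
    (y : Fin d → ℤ) (hY : ∑ i, v i * y i = h * Y) :
    ‖II v (fun θ => φ θ * ∏ i, (Complex.exp (-((v i : ℂ) + θ i * Complex.I)) - 1) ^ α i) y‖ ≤
      Real.exp C * (3 ^ (∑ i, α i) * ((2 + 2 / c) * √(Real.pi / c)) ^ d) *
        (h ^ (d + ∑ i, α i) * Real.exp (-(h * Y))) := by
  set W : Fin d → ℝ → ℝ := fun i t =>
    3 ^ α i * h ^ α i * ((2 + 2 / c) * Real.exp (-(c / h ^ 2) * t ^ 2)) with hW
  have key : ‖∫ θ, (φ θ * ∏ i, (Complex.exp (-((v i : ℂ) + θ i * Complex.I)) - 1) ^ α i) *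
      Complex.exp (-zd v θ y) ∂(muT d)‖ ≤
      ∫ θ, (Real.exp C * Real.exp (-(h * Y))) * ∏ i, W i (θ i) ∂(muT d) := by
    refine MeasureTheory.norm_integral_le_of_norm_le ?_ ?_
    · apply integrable_muT
      simp only [hW]
      fun_prop
    · filter_upwards [ae_muT d] with θ hθ
      rw [norm_mul, norm_exp_zd, hY, norm_mul, norm_prod]
      have h1 : ∏ i, ‖(Complex.exp (-((v i : ℂ) + θ i * Complex.I)) - 1) ^ α i‖ ≤
          ∏ i, (3 * (|θ i| + h)) ^ α i := by
        refine Finset.prod_le_prod (fun _ _ => norm_nonneg _) fun i _ => ?_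
        rw [norm_pow]
        refine pow_le_pow_left₀ (norm_nonneg _) ?_ _
        refine (aux_exp_sub_one _ _ ((hv i).trans hh1)).trans ?_
        linarith [hv i]
      have h2 : Real.exp (C - (2 * c) * ∑ i, (θ i / h) ^ 2) =
          Real.exp C * ∏ i, Real.exp (-(2 * c) * (θ i / h) ^ 2) := by
        rw [← Real.exp_sum, ← Real.exp_add, ← Finset.mul_sum]
        congr 1
        ring
      have h3 := mul_le_mul (hb θ hθ) h1 (Finset.prod_nonneg fun _ _ => norm_nonneg _)
        (Real.exp_pos _).le
      rw [h2] at h3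
      have h4 : ∏ i, ((3 * (|θ i| + h)) ^ α i * Real.exp (-(2 * c) * (θ i / h) ^ 2)) ≤
          ∏ i, W i (θ i) := by
        refine Finset.prod_le_prod (fun _ _ => by positivity) fun i _ => ?_
        exact aux_poly_gauss c h (θ i) hc hh (α i) (hα i)
      rw [Finset.prod_mul_distrib] at h4
      have h5 := mul_le_mul_of_nonneg_left h4 (Real.exp_pos C).le
      have h6 := mul_le_mul_of_nonneg_right (h3.trans (le_trans (le_of_eq (by ring)) h5))
        (Real.exp_pos (-(h * Y))).le
      refine h6.trans (le_of_eq (by ring))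
  have hint : ∀ i, ∫ t in Set.Icc (-Real.pi) Real.pi, W i t ≤
      3 ^ α i * h ^ α i * (((2 + 2 / c) * √(Real.pi / c)) * h) := by
    intro i
    simp only [hW]
    rw [MeasureTheory.integral_const_mul, MeasureTheory.integral_const_mul]
    have hb : 0 < c / h ^ 2 := by positivity
    have h1 : ∫ t in Set.Icc (-Real.pi) Real.pi, Real.exp (-(c / h ^ 2) * t ^ 2) ≤
        √(Real.pi / c) * h := by
      have e : √(Real.pi / c) * h = √(Real.pi / (c / h ^ 2)) := by
        have : Real.pi / (c / h ^ 2) = Real.pi / c * h ^ 2 := by field_simp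
        rw [this, Real.sqrt_mul (by positivity), Real.sqrt_sq hh.le]
      rw [e, ← integral_gaussian]
      refine MeasureTheory.setIntegral_le_integral (integrable_exp_neg_mul_sq hb) ?_
      exact Filter.Eventually.of_forall fun t => (Real.exp_pos _).le
    calc _ ≤ 3 ^ α i * h ^ α i * ((2 + 2 / c) * (√(Real.pi / c) * h)) := by gcongr
      _ = _ := by ring
  have hprod : ∫ θ, ∏ i, W i (θ i) ∂(muT d) ≤
      3 ^ (∑ i, α i) * ((2 + 2 / c) * √(Real.pi / c)) ^ d * h ^ (d + ∑ i, α i) := by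
    unfold muT
    rw [MeasureTheory.integral_fintype_prod_eq_prod]
    refine (Finset.prod_le_prod (fun i _ => ?_) fun i _ => hint i).trans (le_of_eq ?_)
    · refine MeasureTheory.integral_nonneg fun t => ?_
      simp only [hW]
      positivity
    · rw [Finset.prod_mul_distrib, Finset.prod_mul_distrib, Finset.prod_pow_eq_pow_sum,
        Finset.prod_pow_eq_pow_sum, Finset.prod_const, Finset.card_univ, Fintype.card_fin, mul_pow,
        pow_add]
      ring
  rw [MeasureTheory.integral_const_mul] at key
  unfold II
  rw [norm_mul]
  have hK : ‖(((2 * Real.pi) ^ d : ℝ) : ℂ)⁻¹‖ ≤ 1 := by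
    rw [norm_inv, Complex.norm_real, Real.norm_of_nonneg (by positivity)]
    refine inv_le_one_of_one_le₀ (one_le_pow₀ ?_)
    linarith [Real.pi_gt_three]
  refine (mul_le_of_le_one_left (norm_nonneg _) hK).trans (key.trans ?_)
  refine (mul_le_mul_of_nonneg_left hprod (by positivity)).trans (le_of_eq (by ring))

lemma kernel_pointwise (d d₁ : ℕ) (hd : 1 ≤ d) (hdd₁ : d ≤ d₁)
    (l : Fin d₁ → Fin d → ℤ) (hl : ∀ (k : Fin d₁) (hk : (k : ℕ) < d), l k = stdE d ⟨k, hk⟩)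
    (δ₁ δ₂ : ℝ) (hδ₁ : 0 < δ₁) (hδ₁₂ : δ₁ ≤ δ₂)
    (ρ : ℝ) (hρ : 0 < ρ) (hρ' : ρ < (2 * d₁ * δ₂)⁻¹) :
    ∃ M : ℝ, 0 < M ∧
      ∀ lam : Fin d₁ → ℤ → ℝ, (∀ k t, lam k t ∈ Set.Icc δ₁ δ₂) →
      ∀ G : ℤ → ℤ → (Fin d → ℤ) → ℝ,
        (∀ (m : ℤ) (y : Fin d → ℤ), G m m y = if y = 0 then 1 else 0) →
        (∀ m nn : ℤ, m ≤ nn → ∀ y, G m (nn + 1) y =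
          G m nn y + ρ * ∑ k, lam k nn * (G m nn (y + l k) - 2 * G m nn y + G m nn (y - l k))) →
      ∀ (j : ℤ) (T : ℕ), 1 ≤ T → ∀ α : Fin d → ℕ, (∑ i, α i) ≤ 2 →
      ∀ (y : Fin d → ℤ) (i : Fin d), y i ≠ 0 →
        |mdiff 1 α (G j (j + T)) y| ≤ M * (|(y i : ℝ)| ^ (d + ∑ i, α i))⁻¹ := by
  have hδ₂ : 0 < δ₂ := hδ₁.trans_le hδ₁₂
  have hd₁ : (0 : ℝ) < d₁ := by exact_mod_cast (by omega : 0 < d₁)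
  set q : ℝ := (1 - 2 * d₁ * δ₂ * ρ) / d₁ with hqd
  have hq : 0 < q := by
    apply div_pos _ hd₁
    have : ρ * (2 * d₁ * δ₂) < 1 := by
      rwa [← lt_div_iff₀ (by positivity), one_div]
    linarith
  set L : ℝ := ∑ k, ∑ i, (l k i : ℝ) ^ 2 with hLd
  have hL : 0 ≤ L := by positivity
  have hLk : ∀ k i, (l k i : ℝ) ^ 2 ≤ L := by
    intro k i
    refine le_trans ?_ (Finset.single_le_sum (f := fun k => ∑ i, (l k i : ℝ) ^ 2)
      (fun k _ => by positivity) (Finset.mem_univ k))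
    exact Finset.single_le_sum (f := fun i => (l k i : ℝ) ^ 2)
      (fun k _ => by positivity) (Finset.mem_univ i)
  set C : ℝ := L / 2 * Real.exp (L / 2) with hCd
  have hC : 0 ≤ C := by positivity
  set c : ℝ := 2 * q * ρ * δ₁ / Real.pi ^ 2 with hcd
  have hc : 0 < c := by have := Real.pi_pos; positivity
  have hpi := Real.pi_pos
  refine ⟨Real.exp C * (3 ^ 2 * ((2 + 2 / c) * √(Real.pi / c)) ^ d) * (d + 2).factorial,
    by positivity, ?_⟩
  intro lam hlam G h0 h1 j T hT α hα y i hyi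
  have hTp : (0 : ℝ) < T := by exact_mod_cast hT
  set h : ℝ := (√(T : ℝ))⁻¹ with hhd
  have hh : 0 < h := by positivity
  have hh2 : h ^ 2 = (T : ℝ)⁻¹ := by rw [hhd, inv_pow, Real.sq_sqrt hTp.le]
  have hT1 : (1 : ℝ) ≤ T := by exact_mod_cast hT
  have hh21 : h ^ 2 ≤ 1 := by rw [hh2]; exact inv_le_one_of_one_le₀ hT1
  have hh1 : h ≤ 1 := by nlinarith
  have hyR : (y i : ℝ) ≠ 0 := by exact_mod_cast hyi
  obtain ⟨σ, hσy, hσ1⟩ : ∃ σ : ℝ, σ * y i = |(y i : ℝ)| ∧ |σ| ≤ 1 := by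
    rcases lt_or_gt_of_ne hyR with hlt | hgt
    · exact ⟨-1, by rw [abs_of_neg hlt]; ring, by simp⟩
    · exact ⟨1, by rw [abs_of_pos hgt]; ring, by simp⟩
  have hσ2 : σ ^ 2 ≤ 1 := by
    rw [← sq_abs]; exact pow_le_one₀ (abs_nonneg _) hσ1
  set v : Fin d → ℝ := fun m => if m = i then σ * h else 0 with hvd
  have hvs : ∀ z : Fin d → ℤ, ∑ m, v m * z m = σ * h * z i := by
    intro z; simp [hvd]
  have hv : ∀ m, |v m| ≤ h := by
    intro m
    simp only [hvd]
    split_ifs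
    · rw [abs_mul, abs_of_pos hh]; nlinarith
    · simpa using hh.le
  have hvc : ∀ k, Real.cosh (∑ i, v i * l k i) - 1 ≤ h ^ 2 * C := by
    intro k
    refine aux_cosh _ _ _ hh21 hL ?_
    rw [hvs, mul_pow, mul_pow]
    have := hLk k i
    have h3 : σ ^ 2 * h ^ 2 ≤ h ^ 2 := mul_le_of_le_one_left (sq_nonneg _) hσ2
    exact mul_le_mul h3 this (sq_nonneg _) (sq_nonneg _)
  set φ : (Fin d → ℝ) → ℂ := fun θ =>
      ∏ t ∈ Finset.range T, aS ρ l (fun k => lam k (j + t)) v θ with hφd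
  have hφ : Continuous φ := continuous_finsetProd _ fun t _ => aS_cont _ _ _ _
  have hb : ∀ θ : Fin d → ℝ, (∀ i, |θ i| ≤ Real.pi) →
      ‖φ θ‖ ≤ Real.exp (C - (2 * c) * ∑ i, (θ i / h) ^ 2) := by
    intro θ hθ
    simp only [hφd]
    rw [norm_prod]
    calc ∏ t ∈ Finset.range T, ‖aS ρ l (fun k => lam k (j + t)) v θ‖
        ≤ ∏ t ∈ Finset.range T, Real.exp (h ^ 2 * C - (2 * c) * ∑ i, θ i ^ 2) := by
          refine Finset.prod_le_prod (fun _ _ => norm_nonneg _) fun t _ => ?_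
          refine aS_bound hdd₁ l hl δ₁ ρ q C h hδ₁ hρ hq.le hC _ (fun k => (hlam k _).1) ?_ v hvc θ hθ
          calc ∑ k, (q + 2 * ρ * lam k (j + t)) ≤ ∑ k : Fin d₁, (q + 2 * ρ * δ₂) := by
                refine Finset.sum_le_sum fun k _ => ?_
                have := (hlam k (j + t)).2
                have := mul_le_mul_of_nonneg_left this (by positivity : 0 ≤ 2 * ρ)
                linarith
            _ = 1 := by
                rw [Finset.sum_const, Finset.card_univ, Fintype.card_fin, nsmul_eq_mul, hqd]
                field_simp
                ring
            _ ≤ 1 := le_rfl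
      _ = Real.exp (C - (2 * c) * ∑ i, (θ i / h) ^ 2) := by
          rw [Finset.prod_const, Finset.card_range, ← Real.exp_nat_mul]
          congr 1
          simp only [div_pow, hh2]
          rw [← Finset.sum_div, div_inv_eq_mul]
          field_simp
  have rep := II_mdiff v α hφ (G j (j + T)) (II_rep ρ l lam G h0 h1 v j T) y
  have hαi : ∀ m, α m ≤ 2 := fun m =>
    (Finset.single_le_sum (f := α) (fun _ _ => Nat.zero_le _) (Finset.mem_univ m)).trans hα
  have B := II_bound c C h |(y i : ℝ)| hc hh hh1 v hv α hαi φ hb y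
    (by rw [hvs, ← hσy]; ring)
  rw [← rep, Complex.norm_real, Real.norm_eq_abs] at B
  refine B.trans ?_
  have h4 := aux_decay h |(y i : ℝ)| hh (abs_pos.2 hyR) (d + ∑ i, α i)
  have h5 : ((d + ∑ i, α i).factorial : ℝ) ≤ (d + 2).factorial := by
    exact_mod_cast Nat.factorial_le (by omega)
  have h6 : (3 : ℝ) ^ (∑ i, α i) ≤ 3 ^ 2 := pow_le_pow_right₀ (by norm_num) hα
  calc _ ≤ Real.exp C * (3 ^ 2 * ((2 + 2 / c) * √(Real.pi / c)) ^ d) *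
        (((d + 2).factorial : ℝ) * (|(y i : ℝ)| ^ (d + ∑ i, α i))⁻¹) := by
        refine mul_le_mul ?_ (h4.trans ?_) (by positivity) (by positivity)
        · gcongr
        · gcongr
    _ = _ := by ring

/-! ### Summation against the maximal function -/

lemma mem_Cbox_zero {d : ℕ} (R : ℕ) (z : Fin d → ℤ) (hz : supNat z < R) : z ∈ Cbox R 0 := by
  have h : ∀ i, (z i).natAbs < R := fun i =>
    lt_of_le_of_lt (Finset.le_sup (f := fun i => (z i).natAbs) (Finset.mem_univ i)) hz
  unfold Cbox
  rw [Finset.mem_Icc]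
  constructor <;> intro i <;> have := h i <;> simp only [Pi.zero_apply] <;> omega

lemma sum_dyadic {d : ℕ} (f : (Fin d → ℤ) → ℝ) (S : Finset (Fin d → ℤ)) (r s : ℕ) (hr : 1 ≤ r)
    (hs : 1 ≤ s) (hS : ∀ z ∈ S, r ≤ supNat z) (A : ℝ) (hA : 0 ≤ A)
    (hM : ∀ R : ℕ, 1 ≤ R → ∑ y ∈ Cbox R 0, |f y| ≤ (2 * R : ℝ) ^ d * A) :
    ∑ z ∈ S, ((supNat z : ℝ) ^ (d + s))⁻¹ * |f z| ≤ 2 * 4 ^ d * ((r : ℝ) ^ s)⁻¹ * A := by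
  classical
  have hr0 : (0 : ℝ) < r := by exact_mod_cast hr
  set K := S.sup supNat + 1 with hK
  have h1 : ∀ z ∈ S, ((supNat z : ℝ) ^ (d + s))⁻¹ * |f z| ≤
      ∑ k ∈ Finset.range K, (((2 : ℝ) ^ k * r) ^ (d + s))⁻¹ *
        (if supNat z < 2 ^ (k + 1) * r then |f z| else 0) := by
    intro z hz
    have hrz := hS z hz
    set k := Nat.log 2 (supNat z / r) with hk
    have hne : supNat z / r ≠ 0 := by
      have := Nat.div_pos hrz hr
      omega
    have hk1 : 2 ^ k * r ≤ supNat z := by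
      have := Nat.pow_log_le_self 2 hne
      exact (Nat.le_div_iff_mul_le hr).1 this
    have hk2 : supNat z < 2 ^ (k + 1) * r := by
      have := Nat.lt_pow_succ_log_self (b := 2) (by norm_num) (supNat z / r)
      exact (Nat.div_lt_iff_lt_mul hr).1 this
    have hkK : k ∈ Finset.range K := by
      rw [Finset.mem_range, hK]
      have a1 : k ≤ supNat z / r := Nat.log_le_self _ _
      have a2 : supNat z / r ≤ supNat z := Nat.div_le_self _ _
      have a3 : supNat z ≤ S.sup supNat := Finset.le_sup hz
      omega
    refine le_trans ?_ (Finset.single_le_sum (f := fun k => (((2 : ℝ) ^ k * r) ^ (d + s))⁻¹ *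
        (if supNat z < 2 ^ (k + 1) * r then |f z| else 0)) (fun k _ => ?_) hkK)
    · simp only [if_pos hk2]
      have hk1' : (2 : ℝ) ^ k * r ≤ supNat z := by exact_mod_cast hk1
      gcongr
    · refine mul_nonneg (by positivity) ?_
      split_ifs <;> positivity
  refine (Finset.sum_le_sum h1).trans ?_
  rw [Finset.sum_comm]
  have h2 : ∀ k ∈ Finset.range K, ∑ z ∈ S, (((2 : ℝ) ^ k * r) ^ (d + s))⁻¹ *
        (if supNat z < 2 ^ (k + 1) * r then |f z| else 0) ≤
        (1 / 2 : ℝ) ^ k * (4 ^ d * ((r : ℝ) ^ s)⁻¹ * A) := by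
    intro k _
    rw [← Finset.mul_sum, ← Finset.sum_filter]
    have h3 : ∑ z ∈ S with supNat z < 2 ^ (k + 1) * r, |f z| ≤
        (2 * (2 ^ (k + 1) * r : ℕ) : ℝ) ^ d * A := by
      refine le_trans ?_ (hM (2 ^ (k + 1) * r) (Nat.mul_pos (by positivity) hr))
      refine Finset.sum_le_sum_of_subset_of_nonneg (fun z hz => ?_) fun _ _ _ => abs_nonneg _
      exact mem_Cbox_zero _ _ (Finset.mem_filter.1 hz).2
    refine (mul_le_mul_of_nonneg_left h3 (by positivity)).trans ?_
    have e1 : (2 * ((2 ^ (k + 1) * r : ℕ) : ℝ)) = 4 * (2 ^ k * r) := by push_cast; ring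
    rw [e1, mul_pow 4, pow_add _ d s]
    have hp : ((2 : ℝ) ^ k * r) ^ d ≠ 0 := by positivity
    have e2 : (((2 : ℝ) ^ k * r) ^ d * (2 ^ k * r) ^ s)⁻¹ * (4 ^ d * (2 ^ k * r) ^ d * A) =
        (((2 : ℝ) ^ k) ^ s)⁻¹ * (4 ^ d * ((r : ℝ) ^ s)⁻¹ * A) := by
      rw [mul_pow _ _ s]
      field_simp
    rw [e2]
    refine mul_le_mul_of_nonneg_right ?_ (by positivity)
    rw [one_div, inv_pow]
    have : (2 : ℝ) ^ k ≤ (2 ^ k) ^ s :=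
      le_self_pow₀ (one_le_pow₀ (by norm_num)) (by omega)
    gcongr
  refine (Finset.sum_le_sum h2).trans ?_
  rw [← Finset.sum_mul]
  have := sum_geometric_two_le K
  calc _ ≤ 2 * (4 ^ d * ((r : ℝ) ^ s)⁻¹ * A) := by gcongr
    _ = _ := by ring

lemma maxX_bound {d : ℕ} (g : ℤ → (Fin d → ℤ) → ℝ) (j : ℤ)
    (hg : (Function.support (g j)).Finite) (R : ℕ) (hR : 1 ≤ R) :
    ∑ y ∈ Cbox R 0, |g j y| ≤ (2 * R : ℝ) ^ d * maxX g j 0 := by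
  classical
  have hbdd : BddAbove (Set.range fun r : ℕ+ =>
      (((2 * (r : ℕ) - 1 : ℕ) : ℝ) ^ d)⁻¹ * ∑ y ∈ Cbox (r : ℕ) (0 : Fin d → ℤ), |g j y|) := by
    refine ⟨∑ y ∈ hg.toFinset, |g j y|, ?_⟩
    rintro _ ⟨r, rfl⟩
    have hr := r.2
    have h1 : (1 : ℝ) ≤ ((2 * (r : ℕ) - 1 : ℕ) : ℝ) := by
      have : 1 ≤ 2 * (r : ℕ) - 1 := by have := r.pos; omega
      exact_mod_cast this
    have h2 : ∑ y ∈ Cbox (r : ℕ) (0 : Fin d → ℤ), |g j y| ≤ ∑ y ∈ hg.toFinset, |g j y| := by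
      rw [← Finset.sum_filter_ne_zero]
      refine Finset.sum_le_sum_of_subset_of_nonneg (fun z hz => ?_) fun _ _ _ => abs_nonneg _
      have := (Finset.mem_filter.1 hz).2
      simpa using this
    refine le_trans (mul_le_of_le_one_left (Finset.sum_nonneg fun _ _ => abs_nonneg _) ?_) h2
    exact inv_le_one_of_one_le₀ (one_le_pow₀ h1)
  have h := le_ciSup hbdd ⟨R, hR⟩
  simp only [PNat.mk_coe] at h
  change _ ≤ maxX g j 0 at h
  have h1 : (0 : ℝ) < ((2 * R - 1 : ℕ) : ℝ) := by
    have : 0 < 2 * R - 1 := by omega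
    exact_mod_cast this
  rw [inv_mul_le_iff₀ (by positivity)] at h
  have h0 : 0 ≤ maxX g j 0 := by
    refine Real.iSup_nonneg fun r => ?_
    exact mul_nonneg (by positivity) (Finset.sum_nonneg fun _ _ => abs_nonneg _)
  refine h.trans (mul_le_mul_of_nonneg_right ?_ h0)
  have : ((2 * R - 1 : ℕ) : ℝ) ≤ 2 * R := by
    have : 2 * R - 1 ≤ 2 * R := by omega
    exact_mod_cast this
  gcongr

/-- Lemma 5.3: kernel estimate for data supported away from `C_{2r}`. -/
theorem kernel_estimate_far_support
    (d d₁ : ℕ) (hd : 1 ≤ d) (hdd₁ : d ≤ d₁)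
    (l : Fin d₁ → Fin d → ℤ) (hl : ∀ (k : Fin d₁) (hk : (k : ℕ) < d), l k = stdE d ⟨k, hk⟩)
    (δ₁ δ₂ : ℝ) (hδ₁ : 0 < δ₁) (hδ₁₂ : δ₁ ≤ δ₂)
    (ρ : ℝ) (hρ : 0 < ρ) (hρ' : ρ < (2 * d₁ * δ₂)⁻¹) :
    ∃ N : ℝ, 0 < N ∧
      ∀ lam : Fin d₁ → ℤ → ℝ, (∀ k t, lam k t ∈ Set.Icc δ₁ δ₂) →
      ∀ G : ℤ → ℤ → (Fin d → ℤ) → ℝ,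
        (∀ (m : ℤ) (y : Fin d → ℤ), G m m y = if y = 0 then 1 else 0) →
        (∀ m nn : ℤ, m ≤ nn → ∀ y, G m (nn + 1) y =
          G m nn y + ρ * ∑ k, lam k nn * (G m nn (y + l k) - 2 * G m nn y + G m nn (y - l k))) →
      ∀ r : ℕ, 1 ≤ r →
      ∀ (n : ℤ) (x : Fin d → ℤ), |n| < (r : ℤ) ^ 2 → (∀ i, |x i| < (r : ℤ)) →
      ∀ j : ℤ, j ≤ n - 1 →
      ∀ g : ℤ → (Fin d → ℤ) → ℝ,
        (Function.support fun q : ℤ × (Fin d → ℤ) => g q.1 q.2).Finite →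
        (∀ (t : ℤ) (y : Fin d → ℤ), supNat y < 2 * r → g t y = 0) →
      ∀ α : Fin d → ℕ, (∑ i, α i) = 1 ∨ (∑ i, α i) = 2 →
        |∑' y : Fin d → ℤ, mdiff 1 α (G j n) y * g j (x - y)| ≤
          N * ((r : ℝ) ^ (∑ i, α i))⁻¹ * maxX g j 0 := by
  obtain ⟨M, hMpos, hM⟩ := kernel_pointwise d d₁ hd hdd₁ l hl δ₁ δ₂ hδ₁ hδ₁₂ ρ hρ hρ'
  refine ⟨M * 2 ^ (d + 2) * (2 * 4 ^ d), by positivity, ?_⟩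
  intro lam hlam G h0 h1 r hr n x hn hx j hj g hg hg0 α hα
  classical
  obtain ⟨T, hT⟩ : ∃ T : ℕ, n = j + T := ⟨(n - j).toNat, by omega⟩
  have hT1 : 1 ≤ T := by omega
  subst hT
  set s := ∑ i, α i with hs
  have hs1 : 1 ≤ s := by omega
  have hs2 : s ≤ 2 := by omega
  have hfin : (Function.support (g j)).Finite := by
    refine (hg.image Prod.snd).subset fun y hy => ⟨(j, y), hy, rfl⟩
  set D := mdiff 1 α (G j (j + T)) with hD
  have e1 : ∑' y, D y * g j (x - y) = ∑' z, D (x - z) * g j z := by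
    rw [← (Equiv.subLeft x).tsum_eq]
    simp
  have e2 : ∑' z, D (x - z) * g j z = ∑ z ∈ hfin.toFinset, D (x - z) * g j z := by
    refine tsum_eq_sum fun z hz => ?_
    have : g j z = 0 := by simpa using hz
    rw [this, mul_zero]
  rw [e1, e2]
  have hA0 : 0 ≤ maxX g j 0 := by
    refine Real.iSup_nonneg fun r => ?_
    exact mul_nonneg (by positivity) (Finset.sum_nonneg fun _ _ => abs_nonneg _)
  have hS : ∀ z ∈ hfin.toFinset, 2 * r ≤ supNat z := by
    intro z hz
    by_contra hlt
    have := hg0 j z (by omega)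
    have h3 : g j z ≠ 0 := by simpa using hz
    exact h3 this
  have hpt : ∀ z ∈ hfin.toFinset, |D (x - z) * g j z| ≤
      M * 2 ^ (d + 2) * (((supNat z : ℝ) ^ (d + s))⁻¹ * |g j z|) := by
    intro z hz
    have h2r := hS z hz
    have : Nonempty (Fin d) := ⟨⟨0, hd⟩⟩
    obtain ⟨i, -, hi⟩ := Finset.exists_mem_eq_sup (Finset.univ : Finset (Fin d))
      Finset.univ_nonempty (fun i => (z i).natAbs)
    change supNat z = (z i).natAbs at hi
    have hxi := hx i
    rw [Int.abs_eq_natAbs] at hxi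
    have hlow : (supNat z : ℤ) ≤ 2 * |(x - z) i| := by
      rw [Pi.sub_apply, Int.abs_eq_natAbs]; omega
    have hne : (x - z) i ≠ 0 := by
      rw [Pi.sub_apply]; omega
    have hb := hM lam hlam G h0 h1 j T hT1 α hs2 (x - z) i hne
    have hlowR : (supNat z : ℝ) / 2 ≤ |(((x - z) i : ℤ) : ℝ)| := by
      have : (supNat z : ℝ) ≤ 2 * |(((x - z) i : ℤ) : ℝ)| := by exact_mod_cast hlow
      linarith
    have hzp : (0 : ℝ) < supNat z := by
      have : 0 < supNat z := by omega
      exact_mod_cast this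
    rw [abs_mul]
    have h5 : (|(((x - z) i : ℤ) : ℝ)| ^ (d + s))⁻¹ ≤ 2 ^ (d + 2) * ((supNat z : ℝ) ^ (d + s))⁻¹ := by
      calc (|(((x - z) i : ℤ) : ℝ)| ^ (d + s))⁻¹ ≤ (((supNat z : ℝ) / 2) ^ (d + s))⁻¹ := by gcongr
        _ = 2 ^ (d + s) * ((supNat z : ℝ) ^ (d + s))⁻¹ := by
            rw [div_pow, inv_div]; ring
        _ ≤ _ := by
            gcongr
            norm_num
    calc |D (x - z)| * |g j z| ≤ (M * (|(((x - z) i : ℤ) : ℝ)| ^ (d + s))⁻¹) * |g j z| :=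
          mul_le_mul_of_nonneg_right hb (abs_nonneg _)
      _ ≤ (M * (2 ^ (d + 2) * ((supNat z : ℝ) ^ (d + s))⁻¹)) * |g j z| := by gcongr
      _ = _ := by ring
  refine (Finset.abs_sum_le_sum_abs _ _).trans ((Finset.sum_le_sum hpt).trans ?_)
  rw [← Finset.mul_sum]
  have := sum_dyadic (g j) hfin.toFinset r s hr hs1 (fun z hz => by have := hS z hz; omega)
    (maxX g j 0) hA0 (maxX_bound g j hfin)
  calc _ ≤ M * 2 ^ (d + 2) * (2 * 4 ^ d * ((r : ℝ) ^ s)⁻¹ * maxX g j 0) := by gcongr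
    _ = _ := by ring
end
end
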